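/- arXiv:math/0508476 — 10 statements merged into one kernel-verified Lean document; each statement's English description precedes it below -/
import Mathlib

section
/- Let h be an orientation-preserving self-homeomorphism of the circle ℝ ∪ {∞} (a homeomorphism of the one-point compactification of ℝ that preserves the circular order induced by the linear order of ℝ) which maps the Farey tessellation onto itself, i.e., for every Farey pair {x,y} the pair {h(x), h(y)} is again a Farey pair, and every Farey pair arises in this way. Then h is induced by an element of PSL₂(ℤ): there exist integers a, b, c, d with ad − bc = 1 such that h(x) = (ax+b)/(cx+d) for every x ∈ ℝ ∪ {∞} (with the standard conventions at ∞ and at the pole). -/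
open OnePoint

noncomputable section

/-- The relation `x < y` on the circle `ℝ ∪ {∞}`, where `∞` is regarded as the top element
of the linear order of `ℝ`. -/
def ltInf (x y : OnePoint ℝ) : Prop :=
  (∃ a b : ℝ, x = (a : OnePoint ℝ) ∧ y = (b : OnePoint ℝ) ∧ a < b) ∨ (y = ∞ ∧ x ≠ ∞)

/-- `y` lies strictly between `x` and `z` (in the positive direction) for the circular order
on `ℝ ∪ {∞}` induced by the linear order of `ℝ`. -/
def circSbtw (x y z : OnePoint ℝ) : Prop :=
  (ltInf x y ∧ ltInf y z) ∨ (ltInf y z ∧ ltInf z x) ∨ (ltInf z x ∧ ltInf x y)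

/-- `x ∈ ℝ ∪ {∞}` is represented by the fraction `p/q` in lowest terms, with `q ≥ 0` and
the convention `∞ = 1/0`. -/
def IsFareyRep (x : OnePoint ℝ) (p q : ℤ) : Prop :=
  Int.gcd p q = 1 ∧ 0 ≤ q ∧
    ((q = 0 ∧ p = 1 ∧ x = ∞) ∨ (0 < q ∧ x = (((p : ℝ) / (q : ℝ) : ℝ) : OnePoint ℝ)))

/-- `{x, y}` is a Farey pair: an unordered pair of distinct elements of `ℚ ∪ {∞}`,
written in lowest terms as `p/q`, `r/s`, with `|p·s − q·r| = 1`. -/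
def IsFareyPair (x y : OnePoint ℝ) : Prop :=
  x ≠ y ∧ ∃ p q r s : ℤ, IsFareyRep x p q ∧ IsFareyRep y r s ∧ |p * s - q * r| = 1

open Filter Topology

/-- The point of `ℝ ∪ {∞}` with homogeneous coordinates `(p : q)`. -/
def fareyPoint (p q : ℤ) : OnePoint ℝ :=
  if q = 0 then ∞ else (((p : ℝ) / (q : ℝ) : ℝ) : OnePoint ℝ)

theorem fareyPoint_neg (p q : ℤ) : fareyPoint (-p) (-q) = fareyPoint p q := by
  simp [fareyPoint, neg_div_neg_eq]

theorem IsFareyRep.eq_fareyPoint {x : OnePoint ℝ} {p q : ℤ} (hx : IsFareyRep x p q) :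
    x = fareyPoint p q := by
  rcases hx with ⟨-, -, ⟨rfl, rfl, rfl⟩ | ⟨hq, rfl⟩⟩
  · simp [fareyPoint]
  · simp [fareyPoint, hq.ne']

theorem IsFareyRep.isCoprime {x : OnePoint ℝ} {p q : ℤ} (hx : IsFareyRep x p q) :
    IsCoprime p q :=
  Int.isCoprime_iff_gcd_eq_one.2 hx.1

theorem exists_isFareyRep_fareyPoint {p q : ℤ} (hpq : IsCoprime p q) :
    IsFareyRep (fareyPoint p q) p q ∨ IsFareyRep (fareyPoint p q) (-p) (-q) := by
  have hg := Int.isCoprime_iff_gcd_eq_one.1 hpq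
  rcases lt_trichotomy q 0 with hq | rfl | hq
  · right
    refine ⟨by simpa using hg, by omega, Or.inr ⟨by omega, ?_⟩⟩
    simp [fareyPoint, hq.ne, neg_div_neg_eq]
  · have hp : p = 1 ∨ p = -1 := Int.isUnit_iff.1 (isCoprime_zero_right.1 hpq)
    rcases hp with rfl | rfl
    · left; simp [IsFareyRep, fareyPoint]
    · right; simp [IsFareyRep, fareyPoint]
  · left
    refine ⟨hg, hq.le, Or.inr ⟨hq, ?_⟩⟩
    simp [fareyPoint, hq.ne']

theorem det_eq_zero_of_fareyPoint_eq {p q r s : ℤ} (h : fareyPoint p q = fareyPoint r s) :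
    p * s - q * r = 0 := by
  unfold fareyPoint at h
  split_ifs at h with hq hs hs
  · simp [hq, hs]
  · exact absurd h.symm (OnePoint.coe_ne_infty _)
  · exact absurd h (OnePoint.coe_ne_infty _)
  · have hq' : (q : ℝ) ≠ 0 := by exact_mod_cast hq
    have hs' : (s : ℝ) ≠ 0 := by exact_mod_cast hs
    have h' := OnePoint.coe_injective h
    rw [div_eq_div_iff hq' hs'] at h'
    have : p * s = r * q := by exact_mod_cast h'
    linarith

theorem eq_or_eq_neg_of_det_eq_zero {p q r s : ℤ} (hpq : IsCoprime p q) (hrs : IsCoprime r s)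
    (h : p * s - q * r = 0) : (r = p ∧ s = q) ∨ (r = -p ∧ s = -q) := by
  obtain ⟨x, y, hxy⟩ := hpq
  have hr : r = (x * r + y * s) * p := by linear_combination (-r) * hxy - y * h
  have hs : s = (x * r + y * s) * q := by linear_combination (-s) * hxy + x * h
  have hk : IsUnit (x * r + y * s) :=
    hrs.isUnit_of_dvd' ⟨p, hr⟩ ⟨q, hs⟩
  rcases Int.isUnit_iff.1 hk with hk | hk
  · left; rw [hk] at hr hs; constructor <;> linarith
  · right; rw [hk] at hr hs; constructor <;> linarith

theorem isFareyPair_fareyPoint {p q r s : ℤ} (h : |p * s - q * r| = 1) :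
    IsFareyPair (fareyPoint p q) (fareyPoint r s) := by
  have hpq : IsCoprime p q := by
    rcases abs_eq (zero_le_one' ℤ) |>.1 h with h | h
    · exact ⟨s, -r, by linarith⟩
    · exact ⟨-s, r, by linarith⟩
  have hrs : IsCoprime r s := by
    rcases abs_eq (zero_le_one' ℤ) |>.1 h with h | h
    · exact ⟨-q, p, by linarith⟩
    · exact ⟨q, -p, by linarith⟩
  refine ⟨fun he => ?_, ?_⟩
  · simp [det_eq_zero_of_fareyPoint_eq he] at h
  · rcases exists_isFareyRep_fareyPoint hpq with h₁ | h₁ <;>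
      rcases exists_isFareyRep_fareyPoint hrs with h₂ | h₂ <;>
      refine ⟨_, _, _, _, h₁, h₂, ?_⟩
    · exact h
    · rw [← h, ← abs_neg]; ring_nf
    · rw [← h, ← abs_neg]; ring_nf
    · rw [← h]; ring_nf

theorem IsFareyPair.abs_det {p q r s : ℤ} (hpq : IsCoprime p q) (hrs : IsCoprime r s)
    (h : IsFareyPair (fareyPoint p q) (fareyPoint r s)) : |p * s - q * r| = 1 := by
  obtain ⟨-, p', q', r', s', h₁, h₂, hd⟩ := h
  rcases eq_or_eq_neg_of_det_eq_zero hpq h₁.isCoprime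
      (det_eq_zero_of_fareyPoint_eq h₁.eq_fareyPoint) with ⟨rfl, rfl⟩ | ⟨rfl, rfl⟩ <;>
    rcases eq_or_eq_neg_of_det_eq_zero hrs h₂.isCoprime
      (det_eq_zero_of_fareyPoint_eq h₂.eq_fareyPoint) with ⟨rfl, rfl⟩ | ⟨rfl, rfl⟩
  · exact hd
  · rw [← hd, ← abs_neg]; ring_nf
  · rw [← hd, ← abs_neg]; ring_nf
  · rw [← hd]; ring_nf

theorem ltInf_coe_coe {x y : ℝ} : ltInf (x : OnePoint ℝ) y ↔ x < y := by
  simp [ltInf]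

theorem ltInf_coe_infty (x : ℝ) : ltInf (x : OnePoint ℝ) ∞ := by
  simp [ltInf]

theorem not_ltInf_infty (x : OnePoint ℝ) : ¬ ltInf ∞ x := by
  simp [ltInf]

theorem mul_mul_pos_iff_cyclic_lt {x y z : ℝ} :
    0 < (x - y) * (y - z) * (z - x) ↔ (x < y ∧ y < z) ∨ (y < z ∧ z < x) ∨ (z < x ∧ x < y) := by
  simp only [mul_pos_iff, mul_neg_iff, sub_pos, sub_neg]
  grind

theorem circSbtw_fareyPoint_iff {p₁ q₁ p₂ q₂ p₃ q₃ : ℤ} (h₁ : IsCoprime p₁ q₁)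
    (h₂ : IsCoprime p₂ q₂) (h₃ : IsCoprime p₃ q₃) :
    circSbtw (fareyPoint p₁ q₁) (fareyPoint p₂ q₂) (fareyPoint p₃ q₃) ↔
      0 < (p₁ * q₂ - q₁ * p₂) * (p₂ * q₃ - q₂ * p₃) * (p₃ * q₁ - q₃ * p₁) := by
  have key {p q r s t : ℤ} (ht : IsCoprime t 0) (hq : q ≠ 0) (hs : s ≠ 0) :
      (p : ℝ) / q < r / s ↔ 0 < (p * s - q * r) * (s * t) * (-(t * q)) := by
    have hq' : (q : ℝ) ≠ 0 := by exact_mod_cast hq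
    have hs' : (s : ℝ) ≠ 0 := by exact_mod_cast hs
    have ht2 : t * t = 1 := by
      rcases Int.isUnit_iff.1 (isCoprime_zero_right.1 ht) with rfl | rfl <;> rfl
    have e : (p * s - q * r) * (s * t) * (-(t * q)) = (r * q - p * s) * (q * s) := by
      linear_combination (-(p * s - q * r) * s * q) * ht2
    have e' : (((r * q - p * s) * (q * s) : ℤ) : ℝ) = ((r : ℝ) / s - p / q) * (q * s) ^ 2 := by
      push_cast; field_simp
    rw [e, ← Int.cast_pos (R := ℝ), e', mul_pos_iff_of_pos_right (by positivity), sub_pos]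
  unfold fareyPoint circSbtw
  by_cases e₁ : q₁ = 0 <;> by_cases e₂ : q₂ = 0 <;> by_cases e₃ : q₃ = 0 <;>
    simp only [e₁, e₂, e₃, if_true, if_false, ltInf_coe_coe, ltInf_coe_infty, not_ltInf_infty]
  · simp
  · simp
  · simp
  · subst e₁
    simp only [false_and, and_false, and_true, or_false, false_or, key h₁ e₂ e₃]
    ring_nf
  · simp
  · subst e₂
    simp only [false_and, and_false, and_true, false_or, key h₂ e₃ e₁]
    ring_nf
  · subst e₃
    simp only [false_and, and_false, and_true, or_false, key h₃ e₁ e₂]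
    ring_nf
  · have f₁ : (q₁ : ℝ) ≠ 0 := by exact_mod_cast e₁
    have f₂ : (q₂ : ℝ) ≠ 0 := by exact_mod_cast e₂
    have f₃ : (q₃ : ℝ) ≠ 0 := by exact_mod_cast e₃
    have e : (((p₁ * q₂ - q₁ * p₂) * (p₂ * q₃ - q₂ * p₃) * (p₃ * q₁ - q₃ * p₁) : ℤ) : ℝ) =
        ((p₁ : ℝ) / q₁ - p₂ / q₂) * (p₂ / q₂ - p₃ / q₃) * (p₃ / q₃ - p₁ / q₁) *
          (q₁ * q₂ * q₃) ^ 2 := by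
      push_cast; field_simp
    rw [← Int.cast_pos (R := ℝ), e, mul_pos_iff_of_pos_right (by positivity),
      mul_mul_pos_iff_cyclic_lt]

/-- A vector having determinant `±1` with both members of a basis `m, n` of `ℤ²` is, up to sign,
`m + n` or `m - n`. -/
theorem fareyPoint_eq_add_or_sub {m₁ m₂ n₁ n₂ w₁ w₂ : ℤ} (hd : m₁ * n₂ - m₂ * n₁ = 1)
    (hm : |w₁ * m₂ - w₂ * m₁| = 1) (hn : |w₁ * n₂ - w₂ * n₁| = 1) :
    fareyPoint w₁ w₂ = fareyPoint (m₁ + n₁) (m₂ + n₂) ∨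
      fareyPoint w₁ w₂ = fareyPoint (m₁ - n₁) (m₂ - n₂) := by
  have hw₁ : w₁ = (w₁ * n₂ - w₂ * n₁) * m₁ - (w₁ * m₂ - w₂ * m₁) * n₁ := by
    linear_combination (-w₁) * hd
  have hw₂ : w₂ = (w₁ * n₂ - w₂ * n₁) * m₂ - (w₁ * m₂ - w₂ * m₁) * n₂ := by
    linear_combination (-w₂) * hd
  rcases (abs_eq (zero_le_one' ℤ)).1 hm with hm | hm <;>
    rcases (abs_eq (zero_le_one' ℤ)).1 hn with hn | hn <;> rw [hm, hn] at hw₁ hw₂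
  · right; rw [hw₁, hw₂]; congr 1 <;> ring
  · left; rw [← fareyPoint_neg, hw₁, hw₂]; congr 1 <;> ring
  · left; rw [hw₁, hw₂]; congr 1 <;> ring
  · right; rw [← fareyPoint_neg, hw₁, hw₂]; congr 1 <;> ring

/-- A map preserving Farey pairs and the circular order is determined on the mediant of two
Farey neighbours by its values at these neighbours. -/
theorem map_fareyPoint_add {h : OnePoint ℝ → OnePoint ℝ}
    (horient : ∀ x y z : OnePoint ℝ, circSbtw x y z → circSbtw (h x) (h y) (h z))
    (hfwd : ∀ x y : OnePoint ℝ, IsFareyPair x y → IsFareyPair (h x) (h y))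
    {u₁ u₂ v₁ v₂ m₁ m₂ n₁ n₂ : ℤ} (huv : u₁ * v₂ - u₂ * v₁ = 1) (hmn : m₁ * n₂ - m₂ * n₁ = 1)
    (hu : h (fareyPoint u₁ u₂) = fareyPoint m₁ m₂) (hv : h (fareyPoint v₁ v₂) = fareyPoint n₁ n₂) :
    h (fareyPoint (u₁ + v₁) (u₂ + v₂)) = fareyPoint (m₁ + n₁) (m₂ + n₂) := by
  have cu : IsCoprime u₁ u₂ := ⟨v₂, -v₁, by linarith⟩
  have cv : IsCoprime v₁ v₂ := ⟨-u₂, u₁, by linarith⟩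
  have cuv : IsCoprime (u₁ + v₁) (u₂ + v₂) := ⟨v₂, -v₁, by linarith⟩
  have cm : IsCoprime m₁ m₂ := ⟨n₂, -n₁, by linarith⟩
  have cn : IsCoprime n₁ n₂ := ⟨-m₂, m₁, by linarith⟩
  have cs : IsCoprime (m₁ - n₁) (m₂ - n₂) := ⟨n₂, -n₁, by linarith⟩
  have fu : IsFareyPair (fareyPoint (u₁ + v₁) (u₂ + v₂)) (fareyPoint u₁ u₂) :=
    isFareyPair_fareyPoint (by
      rw [show (u₁ + v₁) * u₂ - (u₂ + v₂) * u₁ = -1 by linarith]; rfl)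
  have fv : IsFareyPair (fareyPoint (u₁ + v₁) (u₂ + v₂)) (fareyPoint v₁ v₂) :=
    isFareyPair_fareyPoint (by
      rw [show (u₁ + v₁) * v₂ - (u₂ + v₂) * v₁ = 1 by linarith]; rfl)
  have gu := hfwd _ _ fu
  have gv := hfwd _ _ fv
  obtain ⟨-, w₁, w₂, -, -, hw, -⟩ := id gu
  rw [hu, hw.eq_fareyPoint] at gu
  rw [hv, hw.eq_fareyPoint] at gv
  rcases fareyPoint_eq_add_or_sub hmn (gu.abs_det hw.isCoprime cm)
    (gv.abs_det hw.isCoprime cn) with he | he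
  · rw [hw.eq_fareyPoint, he]
  · have ho := horient _ _ _ ((circSbtw_fareyPoint_iff cv cuv cu).2 (by
      rw [show v₁ * (u₂ + v₂) - v₂ * (u₁ + v₁) = -1 by linarith,
        show (u₁ + v₁) * u₂ - (u₂ + v₂) * u₁ = -1 by linarith, huv]
      norm_num))
    rw [hu, hv, hw.eq_fareyPoint, he, circSbtw_fareyPoint_iff cn cs cm,
      show n₁ * (m₂ - n₂) - n₂ * (m₁ - n₁) = -1 by linarith,
      show (m₁ - n₁) * m₂ - (m₂ - n₂) * m₁ = 1 by linarith, hmn] at ho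
    norm_num at ho

theorem map_fareyPoint_columns {h : OnePoint ℝ → OnePoint ℝ}
    (horient : ∀ x y z : OnePoint ℝ, circSbtw x y z → circSbtw (h x) (h y) (h z))
    (hfwd : ∀ x y : OnePoint ℝ, IsFareyPair x y → IsFareyPair (h x) (h y))
    {a b c d : ℤ} (hdet : a * d - b * c = 1)
    (hinf : h (fareyPoint 1 0) = fareyPoint a c) (hzero : h (fareyPoint 0 1) = fareyPoint b d)
    (g : Matrix.SpecialLinearGroup (Fin 2) ℤ) (j : Fin 2) :
    h (fareyPoint (g 0 j) (g 1 j)) =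
      fareyPoint (a * g 0 j + b * g 1 j) (c * g 0 j + d * g 1 j) := by
  have hg : g ∈ Subgroup.closure {ModularGroup.S, ModularGroup.T} := by
    rw [SpecialLinearGroup.SL2Z_generators]; trivial
  have aux (u₁ u₂ v₁ v₂ : ℤ) (huv : u₁ * v₂ - u₂ * v₁ = 1)
      (hu : h (fareyPoint u₁ u₂) = fareyPoint (a * u₁ + b * u₂) (c * u₁ + d * u₂))
      (hv : h (fareyPoint v₁ v₂) = fareyPoint (a * v₁ + b * v₂) (c * v₁ + d * v₂)) :
      h (fareyPoint (u₁ + v₁) (u₂ + v₂)) =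
        fareyPoint (a * (u₁ + v₁) + b * (u₂ + v₂)) (c * (u₁ + v₁) + d * (u₂ + v₂)) := by
    rw [map_fareyPoint_add horient hfwd huv _ hu hv]
    · congr 1 <;> ring
    · linear_combination (u₁ * v₂ - u₂ * v₁) * hdet + huv
  have neg (u₁ u₂ : ℤ)
      (hu : h (fareyPoint u₁ u₂) = fareyPoint (a * u₁ + b * u₂) (c * u₁ + d * u₂)) :
      h (fareyPoint (-u₁) (-u₂)) = fareyPoint (a * -u₁ + b * -u₂) (c * -u₁ + d * -u₂) := by
    rw [fareyPoint_neg, hu, ← fareyPoint_neg]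
    congr 1 <;> ring
  suffices H : ∀ j : Fin 2, h (fareyPoint (g 0 j) (g 1 j)) =
      fareyPoint (a * g 0 j + b * g 1 j) (c * g 0 j + d * g 1 j) from H j
  induction hg using Subgroup.closure_induction_right with
  | one => simp [Fin.forall_fin_two, hinf, hzero]
  | mul_right g _ y hy ih =>
    have hdet_g := g.det_coe
    rw [Matrix.det_fin_two] at hdet_g
    rw [Fin.forall_fin_two] at ih ⊢
    rcases hy with rfl | rfl
    · simpa [Matrix.SpecialLinearGroup.coe_mul, Matrix.mul_apply, Fin.sum_univ_two,
        ModularGroup.coe_S] using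
        And.intro ih.2 (neg _ _ ih.1)
    · simpa [Matrix.SpecialLinearGroup.coe_mul, Matrix.mul_apply, Fin.sum_univ_two,
        ModularGroup.coe_T] using
        And.intro ih.1 (aux _ _ _ _ (by linarith) ih.1 ih.2)
  | mul_inv_cancel g _ y hy ih =>
    have hdet_g := g.det_coe
    rw [Matrix.det_fin_two] at hdet_g
    rw [Fin.forall_fin_two] at ih ⊢
    rcases hy with rfl | rfl
    · simpa [Matrix.SpecialLinearGroup.coe_mul, Matrix.SpecialLinearGroup.coe_inv, Matrix.mul_apply,
        Fin.sum_univ_two, ModularGroup.coe_S, Matrix.adjugate_fin_two] using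
        And.intro (neg _ _ ih.2) ih.1
    · have hsub := aux _ _ _ _ (by linarith) ih.2 (neg _ _ ih.1)
      rw [add_comm (g 0 1), add_comm (g 1 1)] at hsub
      simpa [Matrix.SpecialLinearGroup.coe_mul, Matrix.SpecialLinearGroup.coe_inv, Matrix.mul_apply,
        Fin.sum_univ_two, ModularGroup.coe_T, Matrix.adjugate_fin_two] using
        And.intro ih.1 hsub

theorem map_fareyPoint {h : OnePoint ℝ → OnePoint ℝ}
    (horient : ∀ x y z : OnePoint ℝ, circSbtw x y z → circSbtw (h x) (h y) (h z))
    (hfwd : ∀ x y : OnePoint ℝ, IsFareyPair x y → IsFareyPair (h x) (h y))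
    {a b c d : ℤ} (hdet : a * d - b * c = 1)
    (hinf : h (fareyPoint 1 0) = fareyPoint a c) (hzero : h (fareyPoint 0 1) = fareyPoint b d)
    {p q : ℤ} (hpq : IsCoprime p q) :
    h (fareyPoint p q) = fareyPoint (a * p + b * q) (c * p + d * q) := by
  obtain ⟨x, y, hxy⟩ := hpq
  exact map_fareyPoint_columns horient hfwd hdet hinf hzero
    ⟨!![p, -y; q, x], by rw [Matrix.det_fin_two_of]; linarith⟩ 0

/-- A map preserving Farey pairs and the circular order acts on rational points as the element
of `SL₂(ℤ)` whose columns represent its values at `∞` and `0`. -/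
theorem exists_map_fareyPoint {h : OnePoint ℝ → OnePoint ℝ}
    (horient : ∀ x y z : OnePoint ℝ, circSbtw x y z → circSbtw (h x) (h y) (h z))
    (hfwd : ∀ x y : OnePoint ℝ, IsFareyPair x y → IsFareyPair (h x) (h y)) :
    ∃ a b c d : ℤ, a * d - b * c = 1 ∧ ∀ p q : ℤ, IsCoprime p q →
      h (fareyPoint p q) = fareyPoint (a * p + b * q) (c * p + d * q) := by
  obtain ⟨-, p, q, r, s, hpq, hrs, hd⟩ :=
    hfwd (fareyPoint 1 0) (fareyPoint 0 1) (isFareyPair_fareyPoint rfl)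
  rcases (abs_eq (zero_le_one' ℤ)).1 hd with hd | hd
  · have hdet : p * s - r * q = 1 := by linarith
    exact ⟨p, r, q, s, hdet, fun _ _ => map_fareyPoint horient hfwd hdet hpq.eq_fareyPoint
      hrs.eq_fareyPoint⟩
  · have hdet : p * -s - -r * q = 1 := by linarith
    exact ⟨p, -r, q, -s, hdet, fun _ _ => map_fareyPoint horient hfwd hdet hpq.eq_fareyPoint
      (by rw [fareyPoint_neg, hrs.eq_fareyPoint])⟩

/-- An orientation-preserving self-homeomorphism of the circle `ℝ ∪ {∞}` mapping the Farey
tessellation onto itself is induced by an element of `PSL₂(ℤ)`. -/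
theorem farey_preserving_homeo_is_PSL2Z (h : OnePoint ℝ ≃ₜ OnePoint ℝ)
    (horient : ∀ x y z : OnePoint ℝ, circSbtw x y z → circSbtw (h x) (h y) (h z))
    (hfwd : ∀ x y : OnePoint ℝ, IsFareyPair x y → IsFareyPair (h x) (h y))
    (hsurj : ∀ x y : OnePoint ℝ, IsFareyPair x y →
      ∃ u v : OnePoint ℝ, IsFareyPair u v ∧ h u = x ∧ h v = y) :
    ∃ a b c d : ℤ, a * d - b * c = 1 ∧
      (∀ t : ℝ,
        ((c : ℝ) * t + (d : ℝ) ≠ 0 →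
          h (t : OnePoint ℝ) =
            ((((a : ℝ) * t + (b : ℝ)) / ((c : ℝ) * t + (d : ℝ)) : ℝ) : OnePoint ℝ)) ∧
        ((c : ℝ) * t + (d : ℝ) = 0 → h (t : OnePoint ℝ) = ∞)) ∧
      ((c = 0 → h ∞ = ∞) ∧ (c ≠ 0 → h ∞ = (((a : ℝ) / (c : ℝ) : ℝ) : OnePoint ℝ))) := by
  obtain ⟨a, b, c, d, hdet, hmap⟩ := exists_map_fareyPoint horient hfwd
  have hrat (r : ℚ) : h ((r : ℝ) : OnePoint ℝ) =
      fareyPoint (a * r.num + b * r.den) (c * r.num + d * r.den) := by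
    rw [← hmap _ _ r.isCoprime_num_den]
    simp [fareyPoint, Rat.cast_def]
  have hval (r : ℚ) : h ((r : ℝ) : OnePoint ℝ) = if (c : ℝ) * r + d = 0 then ∞ else
      ((((a : ℝ) * r + b) / ((c : ℝ) * r + d) : ℝ) : OnePoint ℝ) := by
    have hden : (r.den : ℝ) ≠ 0 := by exact_mod_cast r.den_ne_zero
    have hmul (x y : ℤ) : (x : ℝ) * r + y = ((x * r.num + y * r.den : ℤ) : ℝ) / r.den := by
      rw [Rat.cast_def]; push_cast; field_simp
    rw [hrat, fareyPoint, hmul, hmul, div_div_div_cancel_right₀ hden]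
    simp only [div_eq_zero_iff, hden, or_false, Int.cast_eq_zero]
  have hcont (t : ℝ) (ht : (c : ℝ) * t + d ≠ 0) : h (t : OnePoint ℝ) =
      ((((a : ℝ) * t + b) / ((c : ℝ) * t + d) : ℝ) : OnePoint ℝ) := by
    have hne : (𝓝[Set.range ((↑) : ℚ → ℝ)] t).NeBot :=
      mem_closure_iff_nhdsWithin_neBot.1 (Rat.denseRange_cast t)
    have h₁ : Tendsto (fun x : ℝ => h (x : OnePoint ℝ)) (𝓝[Set.range ((↑) : ℚ → ℝ)] t)
        (𝓝 (h (t : OnePoint ℝ))) :=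
      ((h.continuous.comp OnePoint.continuous_coe).tendsto t).mono_left nhdsWithin_le_nhds
    have hf : ContinuousAt (fun x : ℝ => ((a : ℝ) * x + b) / ((c : ℝ) * x + d)) t :=
      ContinuousAt.div (by fun_prop) (by fun_prop) ht
    have h₂ : Tendsto (fun x : ℝ => ((((a : ℝ) * x + b) / ((c : ℝ) * x + d) : ℝ) : OnePoint ℝ))
        (𝓝[Set.range ((↑) : ℚ → ℝ)] t)
        (𝓝 ((((a : ℝ) * t + b) / ((c : ℝ) * t + d) : ℝ) : OnePoint ℝ)) :=
      ((OnePoint.continuous_coe.tendsto _).comp hf.tendsto).mono_left nhdsWithin_le_nhds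
    have hev : ∀ᶠ x in 𝓝 t, (c : ℝ) * x + d ≠ 0 :=
      ContinuousAt.eventually_ne (by fun_prop) ht
    refine tendsto_nhds_unique_of_eventuallyEq h₁ h₂ ?_
    filter_upwards [nhdsWithin_le_nhds hev, self_mem_nhdsWithin]
    rintro _ hx ⟨r, rfl⟩
    rw [hval, if_neg hx]
  have hinf : h ∞ = fareyPoint a c := by
    simpa [fareyPoint] using hmap 1 0 isCoprime_one_left
  refine ⟨a, b, c, d, hdet, fun t => ⟨hcont t, fun ht => ?_⟩, fun hc => ?_, fun hc => ?_⟩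
  · have hc : (c : ℝ) ≠ 0 := by
      rintro hc
      have hd : (d : ℝ) = 0 := by simpa [hc] using ht
      norm_cast at hc hd
      simp [hc, hd] at hdet
    obtain rfl : t = ((-d / c : ℚ) : ℝ) := by
      push_cast; field_simp; linarith
    rw [hval, if_pos ht]
  · rw [hinf, fareyPoint, if_pos hc]
  · rw [hinf, fareyPoint, if_neg hc]

end
end

section
/- Fix a point p = (a,b,c,d,e) ∈ ℝ⁵_{>0} and set f(p) = (ac+bd)/e (the Ptolemy transformation of a Whitehead move). Then for all tangent vectors u, v ∈ ℝ⁵, the alternating 2-form (dlog a ∧ dlog b + dlog b ∧ dlog e + dlog e ∧ dlog a) + (dlog e ∧ dlog c + dlog c ∧ dlog d + dlog d ∧ dlog e), corresponding to the two triangles (a,b,e) and (e,c,d) on either side of the diagonal e, evaluated at (u,v), equals the alternating 2-form (dlog a ∧ dlog f + dlog f ∧ dlog d + dlog d ∧ dlog a) + (dlog b ∧ dlog c + dlog c ∧ dlog f + dlog f ∧ dlog b), corresponding to the two triangles (a,f,d) and (b,c,f) on either side of the new diagonal f, evaluated at (u,v). In other words, the Weil–Petersson two form −2 Σ_T (dlog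 x ∧ dlog y + dlog y ∧ dlog z + dlog z ∧ dlog x), summed over the two triangles adjacent to the flipped edge with edges (x,y,z) in counterclockwise order, is algebraically invariant under a Whitehead move. -/
noncomputable section

/-- The Ptolemy transformation of a Whitehead move: the new diagonal `f = (ac + bd)/e`
as a function of the point `p = (a, b, c, d, e) ∈ ℝ⁵` (coordinates indexed `0,…,4`). -/
def ptolemyF : (Fin 5 → ℝ) → ℝ := fun q => (q 0 * q 2 + q 1 * q 3) / q 4

/-- The wedge of two 1-forms evaluated on tangent vectors `u`, `v`:
`(α ∧ β)(u, v) = α(u)·β(v) − α(v)·β(u)`. -/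
def wedge (α β : (Fin 5 → ℝ) → ℝ) (u v : Fin 5 → ℝ) : ℝ := α u * β v - α v * β u

/-- The differential of the Ptolemy transformation, by the quotient rule. -/
theorem fderiv_ptolemyF_apply (p : Fin 5 → ℝ) (hp : p 4 ≠ 0) (w : Fin 5 → ℝ) :
    fderiv ℝ ptolemyF p w =
      (w 0 * p 2 + p 0 * w 2 + w 1 * p 3 + p 1 * w 3) / p 4 -
        (p 0 * p 2 + p 1 * p 3) * w 4 / p 4 ^ 2 := by
  have h (i : Fin 5) := hasFDerivAt_apply (𝕜 := ℝ) i p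
  have hf : HasFDerivAt ptolemyF _ p :=
    (((h 0).mul (h 2)).add ((h 1).mul (h 3))).mul ((hasDerivAt_inv hp).comp_hasFDerivAt p (h 4))
  rw [hf.fderiv]
  simp
  field_simp
  ring

/-- Invariance of the Weil–Petersson two form under a Whitehead move: at a point
`p = (a,b,c,d,e) ∈ ℝ⁵_{>0}` with `f = (ac+bd)/e`, the 2-form
`dlog a ∧ dlog b + dlog b ∧ dlog e + dlog e ∧ dlog a
  + dlog e ∧ dlog c + dlog c ∧ dlog d + dlog d ∧ dlog e`
(for the triangles `(a,b,e)` and `(e,c,d)`) agrees on all tangent vectors `u, v ∈ ℝ⁵` with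
`dlog a ∧ dlog f + dlog f ∧ dlog d + dlog d ∧ dlog a
  + dlog b ∧ dlog c + dlog c ∧ dlog f + dlog f ∧ dlog b`
(for the triangles `(a,f,d)` and `(b,c,f)`).  Here `(dlog xᵢ)_p(u) = uᵢ/pᵢ` for a coordinate,
and `(dlog f)_p(u) = (Df_p u)/f(p)`. -/
theorem weil_petersson_invariant_under_whitehead (p : Fin 5 → ℝ) (hp : ∀ i, 0 < p i)
    (u v : Fin 5 → ℝ) :
    let dl : Fin 5 → (Fin 5 → ℝ) → ℝ := fun i w => w i / p i
    let dlf : (Fin 5 → ℝ) → ℝ := fun w => fderiv ℝ ptolemyF p w / ptolemyF p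
    (wedge (dl 0) (dl 1) u v + wedge (dl 1) (dl 4) u v + wedge (dl 4) (dl 0) u v) +
      (wedge (dl 4) (dl 2) u v + wedge (dl 2) (dl 3) u v + wedge (dl 3) (dl 4) u v) =
    (wedge (dl 0) dlf u v + wedge dlf (dl 3) u v + wedge (dl 3) (dl 0) u v) +
      (wedge (dl 1) (dl 2) u v + wedge (dl 2) dlf u v + wedge dlf (dl 1) u v) := by
  intro dl dlf
  have h (i : Fin 5) : p i ≠ 0 := (hp i).ne'
  have h0 := h 0
  have h1 := h 1
  have h2 := h 2
  have h3 := h 3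
  have h4 := h 4
  have hs : p 0 * p 2 + p 1 * p 3 ≠ 0 :=
    (add_pos (mul_pos (hp 0) (hp 2)) (mul_pos (hp 1) (hp 3))).ne'
  simp only [dl, dlf, wedge, fderiv_ptolemyF_apply p h4, ptolemyF]
  field_simp
  ring

end
end

section
/- Let B ⊆ L⁺ be a nonempty subset of the positive light cone that is discrete and radially dense, and let C be the closed convex hull of B in ℝ³. Then C ∩ L⁺ = {t·z : z ∈ B, t ≥ 1}. -/
noncomputable section

/-- The Minkowski bilinear form on `ℝ³`: `⟨u,v⟩ = u₁v₁ + u₂v₂ − u₃v₃`. -/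
def mink (u v : Fin 3 → ℝ) : ℝ := u 0 * v 0 + u 1 * v 1 - u 2 * v 2

/-- The positive light cone `L⁺ = {w : ⟨w,w⟩ = 0, w₃ > 0}`. -/
def LPlus : Set (Fin 3 → ℝ) := {w | mink w w = 0 ∧ 0 < w 2}

/-- `B` is discrete: every compact subset of `ℝ³` contains only finitely many points of `B`. -/
def DiscreteIn (B : Set (Fin 3 → ℝ)) : Prop :=
  ∀ K : Set (Fin 3 → ℝ), IsCompact K → (B ∩ K).Finite

/-- `B ⊆ L⁺` is radially dense: `{z/z₃ : z ∈ B}` is dense in the unit circle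
`{(cos θ, sin θ, 1)}`. -/
def RadiallyDense (B : Set (Fin 3 → ℝ)) : Prop :=
  {p : Fin 3 → ℝ | ∃ θ : ℝ, p = ![Real.cos θ, Real.sin θ, 1]} ⊆
    closure {p : Fin 3 → ℝ | ∃ z ∈ B, p = (z 2)⁻¹ • z}

open Filter Topology

theorem mink_nonpos_of_mem_LPlus {x y : Fin 3 → ℝ} (hx : x ∈ LPlus) (hy : y ∈ LPlus) :
    mink x y ≤ 0 := by
  obtain ⟨hx, hx2⟩ := hx
  obtain ⟨hy, hy2⟩ := hy
  simp only [mink] at *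
  have hsq : (x 0 * y 0 + x 1 * y 1) ^ 2 ≤ (x 2 * y 2) ^ 2 := by
    have h : (x 2 * y 2) ^ 2 = (x 0 * x 0 + x 1 * x 1) * (y 0 * y 0 + y 1 * y 1) := by
      rw [show x 0 * x 0 + x 1 * x 1 = x 2 * x 2 by linarith,
        show y 0 * y 0 + y 1 * y 1 = y 2 * y 2 by linarith]
      ring
    nlinarith [sq_nonneg (x 0 * y 1 - x 1 * y 0)]
  linarith [abs_le_of_sq_le_sq' hsq (by positivity)]

theorem eq_smul_of_mink_eq_zero {x y : Fin 3 → ℝ} (hx : x ∈ LPlus) (hy : y ∈ LPlus)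
    (h : mink x y = 0) : x = (x 2 / y 2) • y := by
  obtain ⟨hx, hx2⟩ := hx
  obtain ⟨hy, hy2⟩ := hy
  simp only [mink] at *
  have hxx : x 0 * x 0 + x 1 * x 1 = x 2 * x 2 := by linarith
  have hyy : y 0 * y 0 + y 1 * y 1 = y 2 * y 2 := by linarith
  have hxy : x 0 * y 0 + x 1 * y 1 = x 2 * y 2 := by linarith
  have hdet : x 0 * y 1 - x 1 * y 0 = 0 := by
    have : (x 0 * y 1 - x 1 * y 0) ^ 2 = 0 := by
      linear_combination (y 0 * y 0 + y 1 * y 1) * hxx + x 2 * x 2 * hyy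
        - (x 0 * y 0 + x 1 * y 1 + x 2 * y 2) * hxy
    exact pow_eq_zero_iff two_ne_zero |>.1 this
  have h0 : x 0 * y 2 = x 2 * y 0 := by
    apply mul_right_cancel₀ hx2.ne'
    linear_combination (-x 0) * hxy + y 0 * hxx + x 1 * hdet
  have h1 : x 1 * y 2 = x 2 * y 1 := by
    apply mul_right_cancel₀ hx2.ne'
    linear_combination (-x 1) * hxy + y 1 * hxx - x 0 * hdet
  ext i
  fin_cases i <;> simp <;> field_simp <;> linarith

theorem DiscreteIn.finite_height_le {B : Set (Fin 3 → ℝ)} (hBL : B ⊆ LPlus)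
    (hdisc : DiscreteIn B) (M : ℝ) : (B ∩ {y | y 2 ≤ M}).Finite := by
  refine (hdisc (Set.Icc (fun _ => -M) (fun _ => M)) isCompact_Icc).subset ?_
  rintro y ⟨hyB, hyM⟩
  obtain ⟨hy, hy2⟩ := hBL hyB
  simp only [mink, Set.mem_ofPred_eq] at hy hyM
  have h0 := abs_le_of_sq_le_sq' (show y 0 ^ 2 ≤ y 2 ^ 2 by nlinarith [sq_nonneg (y 1)]) hy2.le
  have h1 := abs_le_of_sq_le_sq' (show y 1 ^ 2 ≤ y 2 ^ 2 by nlinarith [sq_nonneg (y 0)]) hy2.le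
  refine ⟨hyB, fun i => ?_, fun i => ?_⟩ <;> fin_cases i <;> simp <;> linarith

theorem exists_one_le_smul_of_mem_closure_convexHull {B : Set (Fin 3 → ℝ)} (hBL : B ⊆ LPlus)
    (hdisc : DiscreteIn B) {x : Fin 3 → ℝ} (hxC : x ∈ closure (convexHull ℝ B))
    (hx : x ∈ LPlus) : ∃ z ∈ B, ∃ t : ℝ, 1 ≤ t ∧ x = t • z := by
  by_contra! hcon
  have hfin := hdisc.finite_height_le hBL (x 2 + 1)
  have hK : ∀ᶠ K : ℝ in atTop, ∀ y ∈ B ∩ {y | y 2 ≤ x 2 + 1}, x 2 < K * (-mink x y) + y 2 := by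
    rw [hfin.eventually_all]
    rintro y ⟨hyB, -⟩
    have hy := hBL hyB
    rcases (mink_nonpos_of_mem_LPlus hx hy).lt_or_eq with hlt | heq
    · exact (tendsto_atTop_add_const_right _ _
        (tendsto_id.atTop_mul_const (neg_pos.2 hlt))).eventually_gt_atTop _
    · refine Eventually.of_forall fun K => ?_
      have : ¬ 1 ≤ x 2 / y 2 := fun h1 => hcon y hyB _ h1 (eq_smul_of_mink_eq_zero hx hy heq)
      rw [not_le, div_lt_one hy.2] at this
      simpa [heq] using this
  obtain ⟨K, hK, hK0⟩ := (hK.and (eventually_ge_atTop 0)).exists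
  have hm : ∀ᶠ m in 𝓝[>] x 2, ∀ y ∈ B ∩ {y | y 2 ≤ x 2 + 1}, m < K * (-mink x y) + y 2 := by
    rw [hfin.eventually_all]
    exact fun y hy => nhdsWithin_le_nhds (eventually_lt_nhds (hK y hy))
  have hm1 : ∀ᶠ m in 𝓝[>] x 2, m < x 2 + 1 :=
    nhdsWithin_le_nhds (eventually_lt_nhds (lt_add_one _))
  obtain ⟨m, ⟨hm, hm1⟩, (hxm : x 2 < m)⟩ := ((hm.and hm1).and self_mem_nhdsWithin).exists
  have hsub : closure (convexHull ℝ B) ⊆ {y | m ≤ K * (-mink x y) + y 2} := by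
    refine closure_minimal (convexHull_min (fun y hy => ?_) (convex_halfSpace_ge ⟨?_, ?_⟩ _)) ?_
    · by_cases hyM : y 2 ≤ x 2 + 1
      · exact (hm y ⟨hy, hyM⟩).le
      · have := mul_nonneg hK0 (neg_nonneg.2 (mink_nonpos_of_mem_LPlus hx (hBL hy)))
        simp only [Set.mem_ofPred_eq]
        linarith
    · intro u v
      simp only [mink, Pi.add_apply]
      ring
    · intro c u
      simp only [mink, Pi.smul_apply, smul_eq_mul]
      ring
    · refine isClosed_le continuous_const ?_
      unfold mink
      fun_prop
  have := hsub hxC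
  simp only [Set.mem_ofPred_eq, hx.1] at this
  linarith

theorem RadiallyDense.mem_closure_height_gt {B : Set (Fin 3 → ℝ)} (hBL : B ⊆ LPlus)
    (hdisc : DiscreteIn B) (hdense : RadiallyDense B) (M θ : ℝ) :
    ![Real.cos θ, Real.sin θ, 1] ∈
      closure ((fun z : Fin 3 → ℝ => (z 2)⁻¹ • z) '' (B ∩ {z | M < z 2})) := by
  by_contra hθ
  set γ : ℝ → Fin 3 → ℝ := fun a => ![Real.cos a, Real.sin a, 1] with hγ
  set N := (fun z : Fin 3 → ℝ => (z 2)⁻¹ • z) with hN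
  have hγc : Continuous γ := by
    refine continuous_pi fun i => ?_
    fin_cases i <;> simp [hγ] <;> fun_prop
  have hF : (N '' (B ∩ {z | z 2 ≤ M})).Finite := (hdisc.finite_height_le hBL M).image _
  have hcov : ∀ a, γ a ∈ N '' (B ∩ {z | z 2 ≤ M}) ∪ closure (N '' (B ∩ {z | M < z 2})) := by
    intro a
    rw [← hF.isClosed.closure_eq, ← closure_union]
    refine closure_mono ?_ (hdense ⟨a, rfl⟩)
    rintro _ ⟨z, hz, rfl⟩
    rcases le_or_gt (z 2) M with h | h
    · exact Or.inl ⟨z, ⟨hz, h⟩, rfl⟩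
    · exact Or.inr ⟨z, ⟨hz, h⟩, rfl⟩
  have hopen : γ ⁻¹' (closure (N '' (B ∩ {z | M < z 2})))ᶜ ∈ 𝓝 θ :=
    (isClosed_closure.isOpen_compl.preimage hγc).mem_nhds hθ
  obtain ⟨δ, hδ, hball⟩ := Metric.mem_nhds_iff.1 hopen
  have himg : γ '' Metric.ball θ δ ⊆ N '' (B ∩ {z | z 2 ≤ M}) := by
    rintro _ ⟨a, ha, rfl⟩
    exact (hcov a).resolve_right (hball ha)
  have hconn : IsPreconnected (γ '' Metric.ball θ δ) :=
    (convex_ball θ δ).isPreconnected.image _ hγc.continuousOn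
  have hsub : (γ '' Metric.ball θ δ).Subsingleton :=
    hF.countable.isTotallyDisconnected _ himg hconn
  set e := min (δ / 2) 1 with he
  have he0 : 0 < e := by positivity
  have hae : θ + e ∈ Metric.ball θ δ := by
    rw [Metric.mem_ball, Real.dist_eq, add_sub_cancel_left, abs_of_pos he0]
    linarith [min_le_left (δ / 2) 1]
  have heq := hsub ⟨_, hae, rfl⟩ ⟨θ, Metric.mem_ball_self hδ, rfl⟩
  have hc : Real.cos (θ + e) = Real.cos θ := congrFun heq 0
  have hs : Real.sin (θ + e) = Real.sin θ := congrFun heq 1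
  have hsin : Real.sin e = 0 := by
    have h : Real.sin e = Real.sin (θ + e - θ) := by rw [add_sub_cancel_left]
    rw [h, Real.sin_sub, hc, hs]
    ring
  exact (Real.sin_pos_of_pos_of_lt_pi he0
    (by linarith [min_le_right (δ / 2) 1, Real.pi_gt_three])).ne' hsin

theorem exists_eq_smul_circle {z : Fin 3 → ℝ} (hz : z ∈ LPlus) :
    ∃ θ : ℝ, z = z 2 • ![Real.cos θ, Real.sin θ, 1] := by
  obtain ⟨hz, hz2⟩ := hz
  simp only [mink] at hz
  have hnorm : ‖(⟨z 0, z 1⟩ : ℂ)‖ = z 2 := by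
    rw [Complex.norm_def, Complex.normSq_mk, show z 0 * z 0 + z 1 * z 1 = z 2 * z 2 by linarith,
      Real.sqrt_mul_self hz2.le]
  refine ⟨Complex.arg ⟨z 0, z 1⟩, ?_⟩
  have hc := Complex.norm_mul_cos_arg ⟨z 0, z 1⟩
  have hs := Complex.norm_mul_sin_arg ⟨z 0, z 1⟩
  rw [hnorm] at hc hs
  ext i
  fin_cases i <;> simp [hc, hs]

theorem smul_mem_closure_convexHull {B : Set (Fin 3 → ℝ)} (hBL : B ⊆ LPlus)
    (hdisc : DiscreteIn B) (hdense : RadiallyDense B) {z : Fin 3 → ℝ} (hz : z ∈ B) {t : ℝ}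
    (ht : 1 ≤ t) : t • z ∈ closure (convexHull ℝ B) := by
  obtain ⟨θ, hθ⟩ := exists_eq_smul_circle (hBL hz)
  have hz2 := (hBL hz).2
  have hex : ∀ n : ℕ, ∃ w ∈ B, (n : ℝ) < w 2 ∧
      dist ![Real.cos θ, Real.sin θ, 1] ((w 2)⁻¹ • w) < 1 / (n + 1) := by
    intro n
    obtain ⟨_, ⟨w, ⟨hw, hwn⟩, rfl⟩, hd⟩ := Metric.mem_closure_iff.1
      (hdense.mem_closure_height_gt hBL hdisc n θ) (1 / (n + 1)) Nat.one_div_pos_of_nat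
    exact ⟨w, hw, hwn, hd⟩
  choose w hwB hwn hwd using hex
  have hheight : Tendsto (fun n => w n 2) atTop atTop :=
    tendsto_atTop_mono (fun n => (hwn n).le) tendsto_natCast_atTop_atTop
  have hdir : Tendsto (fun n => (w n 2)⁻¹ • w n) atTop (𝓝 ![Real.cos θ, Real.sin θ, 1]) := by
    rw [tendsto_iff_dist_tendsto_zero]
    refine squeeze_zero (fun _ => dist_nonneg) (fun n => ?_) tendsto_one_div_add_atTop_nhds_zero_nat
    rw [dist_comm]
    exact (hwd n).le
  have hs : Tendsto (fun n => (t - 1) * z 2 * (w n 2)⁻¹) atTop (𝓝 0) := by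
    simpa using hheight.inv_tendsto_atTop.const_mul ((t - 1) * z 2)
  have hlim : Tendsto (fun n => (1 - (t - 1) * z 2 * (w n 2)⁻¹) • z +
      ((t - 1) * z 2 * (w n 2)⁻¹) • w n) atTop (𝓝 (t • z)) := by
    have h := ((hs.const_sub 1).smul_const z).add (hdir.const_smul ((t - 1) * z 2))
    have hlimit : (1 - 0 : ℝ) • z + ((t - 1) * z 2) • ![Real.cos θ, Real.sin θ, 1] = t • z := by
      rw [mul_smul, ← hθ]
      module
    rw [hlimit] at h
    simpa only [smul_smul] using h
  refine mem_closure_of_tendsto hlim ?_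
  filter_upwards [hs.eventually (eventually_le_nhds zero_lt_one)] with n hn
  exact convex_convexHull ℝ B (subset_convexHull ℝ B hz) (subset_convexHull ℝ B (hwB n))
    (sub_nonneg.2 hn) (mul_nonneg (mul_nonneg (sub_nonneg.2 ht) hz2.le)
      (inv_nonneg.2 (hBL (hwB n)).2.le)) (sub_add_cancel _ _)

/-- For a nonempty, discrete, radially dense subset `B` of the positive light cone, the
intersection of the closed convex hull of `B` with `L⁺` is `{t·z : z ∈ B, t ≥ 1}`. -/
theorem closed_convexHull_inter_lightCone (B : Set (Fin 3 → ℝ)) (hne : B.Nonempty)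
    (hBL : B ⊆ LPlus) (hdisc : DiscreteIn B) (hdense : RadiallyDense B) :
    closure (convexHull ℝ B) ∩ LPlus = {x | ∃ z ∈ B, ∃ t : ℝ, 1 ≤ t ∧ x = t • z} := by
  ext x
  constructor
  · rintro ⟨hxC, hx⟩
    exact exists_one_le_smul_of_mem_closure_convexHull hBL hdisc hxC hx
  · rintro ⟨z, hz, t, ht, rfl⟩
    obtain ⟨hzz, hz2⟩ := hBL hz
    refine ⟨smul_mem_closure_convexHull hBL hdisc hdense hz ht, ?_, ?_⟩
    · simp only [mink, Pi.smul_apply, smul_eq_mul] at hzz ⊢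
      linear_combination t ^ 2 * hzz
    · exact mul_pos (by linarith) hz2

end
end

section
/- Let B ⊆ L⁺ be radially dense. Then for every v ∈ ℝ³ with ⟨v,v⟩ > 0 there exists z ∈ B with ⟨z,v⟩ > 0. In particular, B is not contained in the half-space {w ∈ ℝ³ : ⟨w,v⟩ ≤ −1}, so no affine plane {w : ⟨w,v⟩ = −1} with spacelike normal v (a hyperbolic plane) is a supporting plane of the convex hull of B; this underlies the assertion that every face of the boundary of the convex hull of a discrete radially dense subset of L⁺ lies in an elliptic or parabolic affine plane. -/
noncomputable section

/-- A spacelike vector pairs positively with some point of the unit circle at height one. -/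
theorem exists_mink_circle_pos {v : Fin 3 → ℝ} (hv : 0 < mink v v) :
    ∃ θ : ℝ, 0 < mink ![Real.cos θ, Real.sin θ, 1] v := by
  let c : ℂ := ⟨v 0, v 1⟩
  have hc : ‖c‖ ^ 2 = v 0 ^ 2 + v 1 ^ 2 := by
    rw [← Complex.normSq_eq_norm_sq, Complex.normSq_apply]
    simp only [c]
    ring
  have h0 : ‖c‖ * Real.cos c.arg = v 0 := Complex.norm_mul_cos_arg c
  have h1 : ‖c‖ * Real.sin c.arg = v 1 := Complex.norm_mul_sin_arg c
  have hlt : v 2 < ‖c‖ := by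
    refine lt_of_pow_lt_pow_left₀ 2 (norm_nonneg c) ?_
    simp only [mink] at hv
    linarith
  refine ⟨c.arg, ?_⟩
  have key : mink ![Real.cos c.arg, Real.sin c.arg, 1] v = ‖c‖ - v 2 := by
    simp only [mink, Matrix.cons_val]
    rw [← h0, ← h1]
    linear_combination ‖c‖ * Real.sin_sq_add_cos_sq c.arg
  rw [key]
  exact sub_pos.mpr hlt

theorem continuous_mink_left (v : Fin 3 → ℝ) : Continuous fun w => mink w v := by
  unfold mink
  fun_prop

theorem mink_smul_left (a : ℝ) (u v : Fin 3 → ℝ) : mink (a • u) v = a * mink u v := by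
  simp only [mink, Pi.smul_apply, smul_eq_mul]
  ring

/-- If `B ⊆ L⁺` is radially dense, then for every spacelike `v` (i.e. `⟨v,v⟩ > 0`) there is
`z ∈ B` with `⟨z,v⟩ > 0`; in particular `B` is not contained in the half-space
`{w : ⟨w,v⟩ ≤ −1}`, so no hyperbolic affine plane `{w : ⟨w,v⟩ = −1}` supports the convex
hull of `B`. -/
theorem radiallyDense_not_in_spacelike_halfSpace (B : Set (Fin 3 → ℝ)) (hBL : B ⊆ LPlus)
    (hdense : RadiallyDense B) (v : Fin 3 → ℝ) (hv : 0 < mink v v) :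
    (∃ z ∈ B, 0 < mink z v) ∧ ¬ B ⊆ {w : Fin 3 → ℝ | mink w v ≤ -1} := by
  obtain ⟨θ, hθ⟩ := exists_mink_circle_pos hv
  obtain ⟨_, hp, z, hz, rfl⟩ := mem_closure_iff.mp (hdense ⟨θ, rfl⟩) {w | 0 < mink w v}
    (isOpen_lt continuous_const (continuous_mink_left v)) hθ
  have hpos : 0 < mink z v := by
    rw [Set.mem_ofPred_eq, mink_smul_left] at hp
    exact pos_of_mul_pos_right hp (inv_nonneg.mpr (hBL hz).2.le)
  refine ⟨⟨z, hz, hpos⟩, fun hsub => ?_⟩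
  have hle : mink z v ≤ -1 := hsub hz
  linarith

end
end

section
/- Let u₁, u₂, u₃ ∈ L⁺ be pairwise non-proportional (no one a positive scalar multiple of another), and let ℓ₁₂, ℓ₁₃, ℓ₂₃ > 0 be given. Then there exist unique t₁, t₂, t₃ > 0 such that the points vᵢ = tᵢ·uᵢ ∈ L⁺ satisfy λ(vᵢ, vⱼ) = ℓᵢⱼ for all i < j. Moreover (t₁, t₂, t₃) depends continuously on (ℓ₁₂, ℓ₁₃, ℓ₂₃). -/
noncomputable section

/-- The lambda length `λ(u,v) = √(−⟨u,v⟩)`. -/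
def lam (u v : Fin 3 → ℝ) : ℝ := Real.sqrt (-(mink u v))

/-- Non-proportional points of the positive light cone have positive lambda length. -/
theorem lam_pos {u v : Fin 3 → ℝ} (hu : u ∈ LPlus) (hv : v ∈ LPlus)
    (huv : ¬ ∃ t : ℝ, 0 < t ∧ u = t • v) : 0 < lam u v := by
  obtain ⟨hu0, hu2⟩ := hu
  obtain ⟨hv0, hv2⟩ := hv
  have hpos : 0 < u 2 * v 2 := mul_pos hu2 hv2
  simp only [mink] at hu0 hv0
  have lagrange : (u 0 * v 0 + u 1 * v 1) ^ 2 + (u 0 * v 1 - u 1 * v 0) ^ 2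
      = (u 2 * v 2) ^ 2 := by
    linear_combination (v 0 ^ 2 + v 1 ^ 2) * hu0 + u 2 ^ 2 * hv0
  have hle : u 0 * v 0 + u 1 * v 1 ≤ u 2 * v 2 :=
    le_of_abs_le <| abs_le_of_sq_le_sq (by linarith [sq_nonneg (u 0 * v 1 - u 1 * v 0)]) hpos.le
  refine Real.sqrt_pos.2 ?_
  simp only [mink]
  by_contra hneg
  have heq : u 0 * v 0 + u 1 * v 1 = u 2 * v 2 := le_antisymm hle (by linarith)
  have hcross : u 0 * v 1 - u 1 * v 0 = 0 := by
    rw [heq] at lagrange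
    exact pow_eq_zero_iff two_ne_zero |>.1 (by linarith)
  refine huv ⟨u 2 / v 2, div_pos hu2 hv2, funext fun i => ?_⟩
  have hne : v 2 ≠ 0 := hv2.ne'
  rw [Pi.smul_apply, smul_eq_mul, div_mul_eq_mul_div, eq_div_iff hne]
  refine mul_right_cancel₀ hne ?_
  fin_cases i
  · change u 0 * v 2 * v 2 = u 2 * v 0 * v 2
    linear_combination v 0 * heq + v 1 * hcross - u 0 * hv0
  · change u 1 * v 2 * v 2 = u 2 * v 1 * v 2
    linear_combination v 1 * heq - v 0 * hcross - u 1 * hv0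
  · rfl

theorem lam_smul_smul {s t : ℝ} (hst : 0 ≤ s * t) (u v : Fin 3 → ℝ) :
    lam (s • u) (t • v) = √(s * t) * lam u v := by
  rw [lam, lam, ← Real.sqrt_mul hst]
  congr 1
  simp only [mink, Pi.smul_apply, smul_eq_mul]
  ring

theorem lam_smul_smul_eq_iff {u v : Fin 3 → ℝ} (h : 0 < lam u v) {s t l : ℝ}
    (hs : 0 < s) (ht : 0 < t) (hl : 0 < l) :
    lam (s • u) (t • v) = l ↔ s * t = (l / lam u v) ^ 2 := by
  have hst := mul_pos hs ht
  rw [lam_smul_smul hst.le, ← eq_div_iff h.ne', Real.sqrt_eq_iff_eq_sq hst.le (by positivity)]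

/-- A positive number is determined by the pairwise products of it and two other numbers. -/
theorem eq_mul_div_of_mul_eq_sq {x y z p q r : ℝ} (hx : 0 < x)
    (hp : 0 < p) (hq : 0 < q) (hr : 0 < r)
    (hxy : x * y = p ^ 2) (hxz : x * z = q ^ 2) (hyz : y * z = r ^ 2) : x = p * q / r := by
  rw [eq_div_iff hr.ne', ← sq_eq_sq₀ (by positivity) (by positivity)]
  rw [mul_pow, mul_pow, ← hxy, ← hxz, ← hyz]
  ring

/-- Given `u₁, u₂, u₃ ∈ L⁺` pairwise non-proportional and prescribed positive lambda lengths
`ℓ₁₂, ℓ₁₃, ℓ₂₃`, there are unique `t₁, t₂, t₃ > 0` with `λ(tᵢuᵢ, tⱼuⱼ) = ℓᵢⱼ` for `i < j`;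
moreover `(t₁,t₂,t₃)` depends continuously on `(ℓ₁₂,ℓ₁₃,ℓ₂₃)`. -/
theorem unique_scalings_realizing_lambda_lengths (u1 u2 u3 : Fin 3 → ℝ)
    (h1 : u1 ∈ LPlus) (h2 : u2 ∈ LPlus) (h3 : u3 ∈ LPlus)
    (h12 : ¬ ∃ t : ℝ, 0 < t ∧ u1 = t • u2)
    (h13 : ¬ ∃ t : ℝ, 0 < t ∧ u1 = t • u3)
    (h23 : ¬ ∃ t : ℝ, 0 < t ∧ u2 = t • u3) :
    ∃ g : ℝ × ℝ × ℝ → ℝ × ℝ × ℝ,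
      ContinuousOn g {l : ℝ × ℝ × ℝ | 0 < l.1 ∧ 0 < l.2.1 ∧ 0 < l.2.2} ∧
      ∀ l12 l13 l23 : ℝ, 0 < l12 → 0 < l13 → 0 < l23 →
        ((0 < (g (l12, l13, l23)).1 ∧ 0 < (g (l12, l13, l23)).2.1 ∧
            0 < (g (l12, l13, l23)).2.2) ∧
          lam ((g (l12, l13, l23)).1 • u1) ((g (l12, l13, l23)).2.1 • u2) = l12 ∧
          lam ((g (l12, l13, l23)).1 • u1) ((g (l12, l13, l23)).2.2 • u3) = l13 ∧
          lam ((g (l12, l13, l23)).2.1 • u2) ((g (l12, l13, l23)).2.2 • u3) = l23) ∧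
        ∀ t1 t2 t3 : ℝ, 0 < t1 → 0 < t2 → 0 < t3 →
          lam (t1 • u1) (t2 • u2) = l12 → lam (t1 • u1) (t3 • u3) = l13 →
          lam (t2 • u2) (t3 • u3) = l23 → (t1, t2, t3) = g (l12, l13, l23) := by
  have m12 := lam_pos h1 h2 h12
  have m13 := lam_pos h1 h3 h13
  have m23 := lam_pos h2 h3 h23
  refine ⟨fun l =>
    ((l.1 / lam u1 u2) * (l.2.1 / lam u1 u3) / (l.2.2 / lam u2 u3),
      (l.1 / lam u1 u2) * (l.2.2 / lam u2 u3) / (l.2.1 / lam u1 u3),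
      (l.2.1 / lam u1 u3) * (l.2.2 / lam u2 u3) / (l.1 / lam u1 u2)), ?_, ?_⟩
  · refine ContinuousOn.prodMk ?_ (ContinuousOn.prodMk ?_ ?_) <;>
      refine ContinuousOn.div (by fun_prop) (by fun_prop) ?_ <;>
      rintro l ⟨hl1, hl2, hl3⟩ <;>
      exact (div_pos ‹_› ‹_›).ne'
  · intro l12 l13 l23 hl12 hl13 hl23
    have p12 := div_pos hl12 m12
    have p13 := div_pos hl13 m13
    have p23 := div_pos hl23 m23
    refine ⟨⟨⟨by positivity, by positivity, by positivity⟩, ?_, ?_, ?_⟩, ?_⟩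
    · rw [lam_smul_smul_eq_iff m12 (by positivity) (by positivity) hl12]
      field_simp
    · rw [lam_smul_smul_eq_iff m13 (by positivity) (by positivity) hl13]
      field_simp
    · rw [lam_smul_smul_eq_iff m23 (by positivity) (by positivity) hl23]
      field_simp
    · intro t1 t2 t3 ht1 ht2 ht3 e12 e13 e23
      rw [lam_smul_smul_eq_iff m12 ht1 ht2 hl12] at e12
      rw [lam_smul_smul_eq_iff m13 ht1 ht3 hl13] at e13
      rw [lam_smul_smul_eq_iff m23 ht2 ht3 hl23] at e23
      refine Prod.ext ?_ (Prod.ext ?_ ?_)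
      · exact eq_mul_div_of_mul_eq_sq ht1 p12 p13 p23 e12 e13 e23
      · exact eq_mul_div_of_mul_eq_sq ht2 p12 p23 p13 (by rwa [mul_comm]) e23 e13
      · exact eq_mul_div_of_mul_eq_sq ht3 p13 p23 p12 (by rwa [mul_comm])
          (by rwa [mul_comm]) e12

end
end

section
/- Let v₁, v₂ ∈ L⁺ be linearly independent and let ℓ₁₃, ℓ₂₃ > 0. For each sign ε ∈ {+1, −1} there is a unique v₃ ∈ L⁺ with λ(v₁, v₃) = ℓ₁₃, λ(v₂, v₃) = ℓ₂₃, and ε·det(v₁, v₂, v₃) > 0, where det denotes the determinant of the 3×3 matrix with columns v₁, v₂, v₃. In particular there are exactly two points of L⁺ realizing the prescribed lambda lengths to v₁ and v₂, one on each side of the plane through the origin spanned by v₁ and v₂, and none on that plane. -/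
noncomputable section

/-- The determinant of the `3×3` matrix with columns `v₁, v₂, v₃`. -/
def detCols (v1 v2 v3 : Fin 3 → ℝ) : ℝ :=
  Matrix.det (Matrix.of fun i j => ![v1, v2, v3] j i)

/-- The Minkowski cross product: the vector representing `detCols u v` with respect to `mink`. -/
def minkCross (u v : Fin 3 → ℝ) : Fin 3 → ℝ :=
  ![u 1 * v 2 - u 2 * v 1, u 2 * v 0 - u 0 * v 2, -(u 0 * v 1 - u 1 * v 0)]

lemma detCols_eq (u v w : Fin 3 → ℝ) :
    detCols u v w = (u 1 * v 2 - u 2 * v 1) * w 0 + (u 2 * v 0 - u 0 * v 2) * w 1 +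
      (u 0 * v 1 - u 1 * v 0) * w 2 := by
  simp [detCols, Matrix.det_fin_three]
  ring

lemma mink_minkCross (u v w : Fin 3 → ℝ) : mink (minkCross u v) w = detCols u v w := by
  simp [mink, minkCross, detCols_eq]
  ring

/-- The squared determinant is minus the Gram determinant of the Minkowski form. -/
lemma detCols_sq (u v w : Fin 3 → ℝ) :
    detCols u v w ^ 2 = -(mink u u * (mink v v * mink w w - mink v w ^ 2) -
      mink u v * (mink u v * mink w w - mink v w * mink u w) +
      mink u w * (mink u v * mink v w - mink v v * mink u w)) := by
  simp only [detCols_eq, mink]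
  ring

lemma mink_minkCross_self (u v : Fin 3 → ℝ) :
    mink (minkCross u v) (minkCross u v) = mink u v ^ 2 - mink u u * mink v v := by
  simp [mink, minkCross]
  ring

lemma detCols_sq_of_null {u v w : Fin 3 → ℝ} (hu : mink u u = 0) (hv : mink v v = 0)
    (hw : mink w w = 0) : detCols u v w ^ 2 = -2 * mink u v * mink u w * mink v w := by
  rw [detCols_sq, hu, hv, hw]
  ring

lemma mink_null_identity {u v : Fin 3 → ℝ} (hu : mink u u = 0) (hv : mink v v = 0) :
    2 * (u 2 * v 2) * -mink u v =
      (v 2 * u 0 - u 2 * v 0) ^ 2 + (v 2 * u 1 - u 2 * v 1) ^ 2 := by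
  simp only [mink] at *
  linear_combination (-(v 2) ^ 2) * hu - (u 2) ^ 2 * hv

lemma mink_neg_of_linearIndependent {u v : Fin 3 → ℝ} (hu : u ∈ LPlus) (hv : v ∈ LPlus)
    (h : LinearIndependent ℝ ![u, v]) : mink u v < 0 := by
  obtain ⟨hu, hu2⟩ := hu
  obtain ⟨hv, hv2⟩ := hv
  have key := mink_null_identity hu hv
  have hpos : 0 < 2 * (u 2 * v 2) := by positivity
  by_contra! hc
  have h0 : 2 * (u 2 * v 2) * mink u v ≥ 0 := by positivity
  have e0 : v 2 * u 0 - u 2 * v 0 = 0 := by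
    nlinarith [sq_nonneg (v 2 * u 0 - u 2 * v 0), sq_nonneg (v 2 * u 1 - u 2 * v 1)]
  have e1 : v 2 * u 1 - u 2 * v 1 = 0 := by
    nlinarith [sq_nonneg (v 2 * u 0 - u 2 * v 0), sq_nonneg (v 2 * u 1 - u 2 * v 1)]
  have hz := (LinearIndependent.pair_iff.mp h (v 2) (-u 2) (by
    ext i
    fin_cases i <;> simp <;> linarith)).1
  exact hv2.ne' hz

lemma mem_LPlus_of_mink_neg {u w : Fin 3 → ℝ} (hu : u ∈ LPlus) (hw : mink w w = 0)
    (h : mink u w < 0) : w ∈ LPlus := by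
  obtain ⟨hu, hu2⟩ := hu
  refine ⟨hw, ?_⟩
  have key := mink_null_identity hu hw
  have hnonneg : 0 ≤ w 2 := by
    by_contra! hc
    have : 2 * (u 2 * w 2) * -mink u w < 0 :=
      mul_neg_of_neg_of_pos (by nlinarith) (by linarith)
    nlinarith [sq_nonneg (w 2 * u 0 - u 2 * w 0), sq_nonneg (w 2 * u 1 - u 2 * w 1)]
  refine hnonneg.lt_of_ne fun hz => ?_
  simp only [mink, ← hz] at hw h
  have e0 : w 0 = 0 := by nlinarith [sq_nonneg (w 0), sq_nonneg (w 1)]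
  have e1 : w 1 = 0 := by nlinarith [sq_nonneg (w 0), sq_nonneg (w 1)]
  simp [e0, e1] at h

lemma eq_of_mink_eq_of_detCols_eq {u v w x : Fin 3 → ℝ} (hu : mink u u = 0)
    (huv : mink u v ≠ 0) (h1 : mink u w = mink u x) (h2 : mink v w = mink v x)
    (h3 : detCols u v w = detCols u v x) : w = x := by
  have hn : mink (minkCross u v) (minkCross u v) ≠ 0 := by
    rw [mink_minkCross_self, hu]
    simpa using huv
  rw [← mink_minkCross, ← mink_minkCross] at h3
  generalize hm : minkCross u v = n at hn h3
  have m0 : n 0 = u 1 * v 2 - u 2 * v 1 := by simp [← hm, minkCross]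
  have m1 : n 1 = u 2 * v 0 - u 0 * v 2 := by simp [← hm, minkCross]
  have m2 : n 2 = -(u 0 * v 1 - u 1 * v 0) := by simp [← hm, minkCross]
  simp only [mink] at hn h1 h2 h3
  ext i
  refine mul_left_cancel₀ hn ?_
  fin_cases i <;> simp only [Fin.zero_eta, Fin.mk_one, Fin.reduceFinMk]
  · linear_combination (v 1 * n 2 - v 2 * n 1) * h1 + (n 1 * u 2 - n 2 * u 1) * h2 +
      (u 1 * v 2 - u 2 * v 1) * h3 + (w 0 - x 0) * (n 0 * m0 + n 1 * m1 - n 2 * m2)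
  · linear_combination (v 2 * n 0 - v 0 * n 2) * h1 + (n 2 * u 0 - n 0 * u 2) * h2 +
      (u 2 * v 0 - u 0 * v 2) * h3 + (w 1 - x 1) * (n 0 * m0 + n 1 * m1 - n 2 * m2)
  · linear_combination (-(v 0 * n 1 - v 1 * n 0)) * h1 + (-(n 0 * u 1 - n 1 * u 0)) * h2 +
      (-(u 0 * v 1 - u 1 * v 0)) * h3 + (w 2 - x 2) * (n 0 * m0 + n 1 * m1 - n 2 * m2)

lemma lam_eq_iff {u v : Fin 3 → ℝ} {l : ℝ} (hl : 0 < l) : lam u v = l ↔ mink u v = -l ^ 2 := by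
  rw [lam, Real.sqrt_eq_iff_mul_self_eq_of_pos hl]
  constructor <;> intro h <;> linarith

lemma exists_null_of_mink_of_detCols {u v : Fin 3 → ℝ} (hu : mink u u = 0) (hv : mink v v = 0)
    (huv : mink u v ≠ 0) {a b d : ℝ} (hd : d ^ 2 = -2 * mink u v * a * b) :
    ∃ w, mink w w = 0 ∧ mink u w = a ∧ mink v w = b ∧ detCols u v w = d := by
  have hn := mink_minkCross_self u v
  have hnu : mink (minkCross u v) u = 0 := by rw [mink_minkCross, detCols_eq]; ring
  have hnv : mink (minkCross u v) v = 0 := by rw [mink_minkCross, detCols_eq]; ring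
  rw [hu, zero_mul, sub_zero] at hn
  simp only [← mink_minkCross]
  generalize minkCross u v = n at *
  generalize hp : mink u v = p at *
  have expand : ∀ x : Fin 3 → ℝ, mink x ((b / p) • u + (a / p) • v + (d / p ^ 2) • n) =
      b / p * mink u x + a / p * mink v x + d / p ^ 2 * mink n x := by
    intro x
    simp only [mink, Pi.add_apply, Pi.smul_apply, smul_eq_mul]
    ring
  have comm : ∀ x y, mink x y = mink y x := by
    intro x y
    simp only [mink]
    ring
  have hwu : mink u ((b / p) • u + (a / p) • v + (d / p ^ 2) • n) = a := by
    rw [expand, hu, comm v u, hp, hnu]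
    field_simp
    ring
  have hwv : mink v ((b / p) • u + (a / p) • v + (d / p ^ 2) • n) = b := by
    rw [expand, hv, hp, hnv]
    field_simp
    ring
  have hwn : mink n ((b / p) • u + (a / p) • v + (d / p ^ 2) • n) = d := by
    rw [expand, comm u n, comm v n, hnu, hnv, hn]
    field_simp
    ring
  refine ⟨_, ?_, hwu, hwv, hwn⟩
  rw [expand, hwu, hwv, hwn]
  field_simp
  linear_combination hd

/-- Given linearly independent `v₁, v₂ ∈ L⁺`, positive `ℓ₁₃, ℓ₂₃` and a sign `ε = ±1`, there
is a unique `v₃ ∈ L⁺` with `λ(v₁,v₃) = ℓ₁₃`, `λ(v₂,v₃) = ℓ₂₃` and `ε·det(v₁,v₂,v₃) > 0`;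
moreover no point of `L⁺` realizing the prescribed lambda lengths lies on the plane through
the origin spanned by `v₁, v₂`. -/
theorem unique_third_point_on_each_side (v1 v2 : Fin 3 → ℝ)
    (h1 : v1 ∈ LPlus) (h2 : v2 ∈ LPlus) (hind : LinearIndependent ℝ ![v1, v2])
    (l13 l23 : ℝ) (hl13 : 0 < l13) (hl23 : 0 < l23) (ε : ℝ) (hε : ε = 1 ∨ ε = -1) :
    (∃! v3 : Fin 3 → ℝ, v3 ∈ LPlus ∧ lam v1 v3 = l13 ∧ lam v2 v3 = l23 ∧
        0 < ε * detCols v1 v2 v3) ∧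
      ∀ v3 ∈ LPlus, lam v1 v3 = l13 → lam v2 v3 = l23 → detCols v1 v2 v3 ≠ 0 := by
  have hp := mink_neg_of_linearIndependent h1 h2 hind
  have hε2 : ε ^ 2 = 1 := by rcases hε with rfl | rfl <;> norm_num
  have hpos : 0 < -2 * mink v1 v2 * l13 ^ 2 * l23 ^ 2 := by
    have : 0 < -2 * mink v1 v2 := by linarith
    positivity
  have hsq : ∀ w ∈ LPlus, lam v1 w = l13 → lam v2 w = l23 →
      detCols v1 v2 w ^ 2 = -2 * mink v1 v2 * l13 ^ 2 * l23 ^ 2 := by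
    intro w hw ha hb
    rw [lam_eq_iff hl13] at ha
    rw [lam_eq_iff hl23] at hb
    rw [detCols_sq_of_null h1.1 h2.1 hw.1, ha, hb]
    ring
  refine ⟨?_, fun w hw ha hb h0 => ?_⟩
  · have hs := Real.sq_sqrt hpos.le
    obtain ⟨w, hw, ha, hb, hd⟩ := exists_null_of_mink_of_detCols h1.1 h2.1 hp.ne
      (a := -l13 ^ 2) (b := -l23 ^ 2)
      (d := ε * √(-2 * mink v1 v2 * l13 ^ 2 * l23 ^ 2)) (by
        rw [mul_pow, hε2, hs]
        ring)
    have hwL : w ∈ LPlus := mem_LPlus_of_mink_neg h1 hw (by rw [ha]; nlinarith)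
    have hwd : 0 < ε * detCols v1 v2 w := by
      rw [hd, ← mul_assoc, ← sq, hε2, one_mul]
      exact Real.sqrt_pos.mpr hpos
    have hwa := (lam_eq_iff hl13).mpr ha
    have hwb := (lam_eq_iff hl23).mpr hb
    refine ⟨w, ⟨hwL, hwa, hwb, hwd⟩, ?_⟩
    rintro x ⟨hx, hxa, hxb, hxd⟩
    refine eq_of_mink_eq_of_detCols_eq h1.1 hp.ne (((lam_eq_iff hl13).mp hxa).trans ha.symm)
      (((lam_eq_iff hl23).mp hxb).trans hb.symm) ?_
    have hε0 : ε ≠ 0 := by rintro rfl; norm_num at hε2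
    refine mul_left_cancel₀ hε0 ((sq_eq_sq₀ hxd.le hwd.le).mp ?_)
    rw [mul_pow, mul_pow, hsq x hx hxa hxb, hsq w hwL hwa hwb]
  · have := hsq w hw ha hb
    rw [h0, zero_pow two_ne_zero] at this
    exact hpos.ne this

end
end

section
/- Let r₁, r₂, r₃, r₄ > 0 and let θ₁ < θ₂ < θ₃ < θ₄ < θ₁ + 2π be real numbers, and set uᵢ = rᵢ·(cos θᵢ, sin θᵢ, 1) ∈ L⁺ (so that the rays through u₁, u₃ separate the rays through u₂, u₄). Then the Ptolemy equation holds: λ(u₁,u₃)·λ(u₂,u₄) = λ(u₁,u₂)·λ(u₃,u₄) + λ(u₁,u₄)·λ(u₂,u₃). -/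
noncomputable section

/-- Lambda length of two light-cone points in terms of their half-angle difference. -/
theorem lam_smul_eq {r s a b : ℝ} (hr : 0 ≤ r) (hs : 0 ≤ s) (hab : a ≤ b)
    (hba : b ≤ a + 2 * Real.pi) :
    lam (r • ![Real.cos a, Real.sin a, 1]) (s • ![Real.cos b, Real.sin b, 1]) =
      √2 * √r * √s * Real.sin (b / 2 - a / 2) := by
  have hsin : 0 ≤ Real.sin (b / 2 - a / 2) :=
    Real.sin_nonneg_of_nonneg_of_le_pi (by linarith) (by linarith)
  have hcos : Real.cos b * Real.cos a + Real.sin b * Real.sin a =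
      1 - 2 * Real.sin (b / 2 - a / 2) ^ 2 := by
    rw [← Real.cos_sub, Real.sin_sq_eq_half_sub]
    ring_nf
  have hmink : -mink (r • ![Real.cos a, Real.sin a, 1]) (s • ![Real.cos b, Real.sin b, 1]) =
      (√2 * √r * √s * Real.sin (b / 2 - a / 2)) ^ 2 := by
    simp only [mink, Pi.smul_apply, smul_eq_mul, Matrix.cons_val, mul_pow,
      Real.sq_sqrt zero_le_two, Real.sq_sqrt hr, Real.sq_sqrt hs]
    linear_combination -(r * s) * hcos
  rw [lam, hmink, Real.sqrt_sq (by positivity)]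

/-- The Ptolemy equation: for four points `uᵢ = rᵢ·(cos θᵢ, sin θᵢ, 1)` of the positive light
cone with `θ₁ < θ₂ < θ₃ < θ₄ < θ₁ + 2π` (so the rays through `u₁, u₃` separate those through
`u₂, u₄`), one has `λ(u₁,u₃)·λ(u₂,u₄) = λ(u₁,u₂)·λ(u₃,u₄) + λ(u₁,u₄)·λ(u₂,u₃)`. -/
theorem ptolemy_equation (r1 r2 r3 r4 θ1 θ2 θ3 θ4 : ℝ)
    (hr1 : 0 < r1) (hr2 : 0 < r2) (hr3 : 0 < r3) (hr4 : 0 < r4)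
    (h12 : θ1 < θ2) (h23 : θ2 < θ3) (h34 : θ3 < θ4) (h41 : θ4 < θ1 + 2 * Real.pi)
    (u1 u2 u3 u4 : Fin 3 → ℝ)
    (hu1 : u1 = r1 • ![Real.cos θ1, Real.sin θ1, 1])
    (hu2 : u2 = r2 • ![Real.cos θ2, Real.sin θ2, 1])
    (hu3 : u3 = r3 • ![Real.cos θ3, Real.sin θ3, 1])
    (hu4 : u4 = r4 • ![Real.cos θ4, Real.sin θ4, 1]) :
    lam u1 u3 * lam u2 u4 = lam u1 u2 * lam u3 u4 + lam u1 u4 * lam u2 u3 := by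
  subst hu1 hu2 hu3 hu4
  rw [lam_smul_eq hr1.le hr3.le (by linarith) (by linarith),
    lam_smul_eq hr2.le hr4.le (by linarith) (by linarith),
    lam_smul_eq hr1.le hr2.le (by linarith) (by linarith),
    lam_smul_eq hr3.le hr4.le (by linarith) (by linarith),
    lam_smul_eq hr1.le hr4.le (by linarith) (by linarith),
    lam_smul_eq hr2.le hr3.le (by linarith) (by linarith)]
  simp only [Real.sin_sub]
  ring

end
end

section
/- Let rᵢ > 0 for i = 1,…,4 and θ₁ < θ₂ < θ₃ < θ₄ < θ₁ + 2π, set uᵢ = rᵢ·(cos θᵢ, sin θᵢ, 1) ∈ L⁺ and λᵢⱼ = λ(uᵢ, uⱼ), and define the simplicial coordinate σ = (λ₁₂² + λ₂₃² − λ₁₃²)/(λ₁₂·λ₂₃·λ₁₃) + (λ₁₄² + λ₃₄² − λ₁₃²)/(λ₁₄·λ₃₄·λ₁₃). Then the determinant det(u₂ − u₁, u₃ − u₁, u₄ − u₁) (six times the signed volume of the Euclidean tetrahedron spanned by u₁, u₂, u₃, u₄) has the same sign as σ: it is positive if and only if σ > 0, negative if and only if σ < 0, and zero if and only if σ = 0,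 the latter occurring exactly when the four points are affinely coplanar. -/
noncomputable section

/-- The point of the light cone with spinor coordinates `(x, y)`. -/
def spinorPoint (x y : ℝ) : Fin 3 → ℝ := ![x ^ 2 - y ^ 2, 2 * x * y, x ^ 2 + y ^ 2]

theorem smul_cos_sin_one_eq_spinorPoint {r : ℝ} (hr : 0 ≤ r) (θ : ℝ) :
    r • ![Real.cos θ, Real.sin θ, 1] =
      spinorPoint (√r * Real.cos (θ / 2)) (√r * Real.sin (θ / 2)) := by
  have hs := Real.sq_sqrt hr
  have hcos : Real.cos θ = Real.cos (θ / 2) ^ 2 - Real.sin (θ / 2) ^ 2 := by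
    rw [← Real.cos_two_mul', mul_div_cancel₀ _ two_ne_zero]
  have hsin : Real.sin θ = 2 * Real.sin (θ / 2) * Real.cos (θ / 2) := by
    rw [← Real.sin_two_mul, mul_div_cancel₀ _ two_ne_zero]
  have hone := Real.sin_sq_add_cos_sq (θ / 2)
  ext i
  fin_cases i
  · simp [spinorPoint, hcos, mul_pow, hs]
    ring
  · simp [spinorPoint, hsin]
    linear_combination (-2 * Real.sin (θ / 2) * Real.cos (θ / 2)) * hs
  · simp [spinorPoint, mul_pow, hs]
    linear_combination -r * hone

theorem lam_spinorPoint {x y z w : ℝ} (h : 0 ≤ x * w - y * z) :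
    lam (spinorPoint x y) (spinorPoint z w) = √2 * (x * w - y * z) := by
  have hm : -mink (spinorPoint x y) (spinorPoint z w) = 2 * (x * w - y * z) ^ 2 := by
    simp [mink, spinorPoint]
    ring
  rw [lam, hm, Real.sqrt_mul zero_le_two, Real.sqrt_sq h]

theorem spinor_wedge_pos {r s α β : ℝ} (hr : 0 < r) (hs : 0 < s) (h : α < β)
    (h' : β < α + 2 * Real.pi) :
    0 < √r * Real.cos (α / 2) * (√s * Real.sin (β / 2)) -
      √r * Real.sin (α / 2) * (√s * Real.cos (β / 2)) := by
  have key : √r * Real.cos (α / 2) * (√s * Real.sin (β / 2)) -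
      √r * Real.sin (α / 2) * (√s * Real.cos (β / 2)) =
      √r * √s * Real.sin (β / 2 - α / 2) := by
    rw [Real.sin_sub]
    ring
  rw [key]
  have := Real.sin_pos_of_pos_of_lt_pi (x := β / 2 - α / 2) (by linarith) (by linarith)
  positivity

theorem detCols_spinorPoint_sub_mul (x₁ y₁ x₂ y₂ x₃ y₃ x₄ y₄ : ℝ) :
    detCols (spinorPoint x₂ y₂ - spinorPoint x₁ y₁) (spinorPoint x₃ y₃ - spinorPoint x₁ y₁)
        (spinorPoint x₄ y₄ - spinorPoint x₁ y₁) * (x₁ * y₃ - y₁ * x₃) =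
      4 * (((x₁ * y₂ - y₁ * x₂) ^ 2 + (x₂ * y₃ - y₂ * x₃) ^ 2 - (x₁ * y₃ - y₁ * x₃) ^ 2) *
            ((x₁ * y₄ - y₁ * x₄) * (x₃ * y₄ - y₃ * x₄)) +
          ((x₁ * y₄ - y₁ * x₄) ^ 2 + (x₃ * y₄ - y₃ * x₄) ^ 2 - (x₁ * y₃ - y₁ * x₃) ^ 2) *
            ((x₁ * y₂ - y₁ * x₂) * (x₂ * y₃ - y₂ * x₃))) := by
  simp [detCols, spinorPoint, Matrix.det_fin_three]
  ring

theorem detCols_eq_zero_iff_not_linearIndependent (v₁ v₂ v₃ : Fin 3 → ℝ) :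
    detCols v₁ v₂ v₃ = 0 ↔ ¬ LinearIndependent ℝ ![v₁, v₂, v₃] := by
  have h : detCols v₁ v₂ v₃ = (Matrix.of ![v₁, v₂, v₃]).det :=
    Matrix.det_transpose (Matrix.of ![v₁, v₂, v₃])
  have h' := Matrix.linearIndependent_rows_iff_isUnit (A := Matrix.of ![v₁, v₂, v₃])
  rw [Matrix.isUnit_iff_isUnit_det, isUnit_iff_ne_zero, ← h] at h'
  exact not_iff_not.mp (h'.symm.trans not_not.symm)

theorem coplanar_iff_not_linearIndependent {V : Type*} [AddCommGroup V] [Module ℝ V]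
    (a b c d : V) :
    Coplanar ℝ {a, b, c, d} ↔ ¬ LinearIndependent ℝ ![b - a, c - a, d - a] := by
  have hspan : vectorSpan ℝ {a, b, c, d} =
      Submodule.span ℝ (Set.range ![b - a, c - a, d - a]) := by
    rw [vectorSpan_eq_span_vsub_set_right ℝ (Set.mem_insert a _)]
    simp only [vsub_eq_sub, Set.image_insert_eq, Set.image_singleton, sub_self,
      Submodule.span_insert_zero, Matrix.range_cons, Matrix.range_empty, Set.union_empty,
      Set.singleton_union]
  have : Module.Finite ℝ (vectorSpan ℝ {a, b, c, d}) :=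
    finiteDimensional_vectorSpan_of_finite ℝ (Set.toFinite _)
  rw [coplanar_iff_finrank_le_two, linearIndependent_iff_card_le_finrank_span, hspan,
    Set.finrank, Fintype.card_fin]
  lia

/-- For four points `uᵢ = rᵢ·(cos θᵢ, sin θᵢ, 1)` of the positive light cone with
`θ₁ < θ₂ < θ₃ < θ₄ < θ₁ + 2π`, the determinant `det(u₂−u₁, u₃−u₁, u₄−u₁)` (six times the
signed volume of the Euclidean tetrahedron on `u₁,…,u₄`) has the same sign as the simplicial
coordinate `σ`, being zero exactly when the four points are affinely coplanar. -/
theorem tetrahedron_volume_sign_eq_simplicial_coordinate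
    (r1 r2 r3 r4 θ1 θ2 θ3 θ4 : ℝ)
    (hr1 : 0 < r1) (hr2 : 0 < r2) (hr3 : 0 < r3) (hr4 : 0 < r4)
    (h12 : θ1 < θ2) (h23 : θ2 < θ3) (h34 : θ3 < θ4) (h41 : θ4 < θ1 + 2 * Real.pi)
    (u1 u2 u3 u4 : Fin 3 → ℝ)
    (hu1 : u1 = r1 • ![Real.cos θ1, Real.sin θ1, 1])
    (hu2 : u2 = r2 • ![Real.cos θ2, Real.sin θ2, 1])
    (hu3 : u3 = r3 • ![Real.cos θ3, Real.sin θ3, 1])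
    (hu4 : u4 = r4 • ![Real.cos θ4, Real.sin θ4, 1])
    (σ : ℝ)
    (hσ : σ = (lam u1 u2 ^ 2 + lam u2 u3 ^ 2 - lam u1 u3 ^ 2) /
          (lam u1 u2 * lam u2 u3 * lam u1 u3) +
        (lam u1 u4 ^ 2 + lam u3 u4 ^ 2 - lam u1 u3 ^ 2) /
          (lam u1 u4 * lam u3 u4 * lam u1 u3)) :
    (0 < detCols (u2 - u1) (u3 - u1) (u4 - u1) ↔ 0 < σ) ∧
    (detCols (u2 - u1) (u3 - u1) (u4 - u1) < 0 ↔ σ < 0) ∧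
    (detCols (u2 - u1) (u3 - u1) (u4 - u1) = 0 ↔ σ = 0) ∧
    (detCols (u2 - u1) (u3 - u1) (u4 - u1) = 0 ↔
      Coplanar ℝ ({u1, u2, u3, u4} : Set (Fin 3 → ℝ))) := by
  have hD : ∃ k > 0, detCols (u2 - u1) (u3 - u1) (u4 - u1) = k * σ := by
    have w12 := spinor_wedge_pos hr1 hr2 h12 (by linarith)
    have w23 := spinor_wedge_pos hr2 hr3 h23 (by linarith)
    have w34 := spinor_wedge_pos hr3 hr4 h34 (by linarith)
    have w13 := spinor_wedge_pos hr1 hr3 (h12.trans h23) (by linarith)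
    have w14 := spinor_wedge_pos hr1 hr4 (h12.trans (h23.trans h34)) h41
    rw [smul_cos_sin_one_eq_spinorPoint hr1.le] at hu1
    rw [smul_cos_sin_one_eq_spinorPoint hr2.le] at hu2
    rw [smul_cos_sin_one_eq_spinorPoint hr3.le] at hu3
    rw [smul_cos_sin_one_eq_spinorPoint hr4.le] at hu4
    have hdet := detCols_spinorPoint_sub_mul
      (√r1 * Real.cos (θ1 / 2)) (√r1 * Real.sin (θ1 / 2))
      (√r2 * Real.cos (θ2 / 2)) (√r2 * Real.sin (θ2 / 2))
      (√r3 * Real.cos (θ3 / 2)) (√r3 * Real.sin (θ3 / 2))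
      (√r4 * Real.cos (θ4 / 2)) (√r4 * Real.sin (θ4 / 2))
    have l12 := lam_spinorPoint w12.le
    have l23 := lam_spinorPoint w23.le
    have l34 := lam_spinorPoint w34.le
    have l13 := lam_spinorPoint w13.le
    have l14 := lam_spinorPoint w14.le
    rw [← hu1, ← hu2, ← hu3, ← hu4] at hdet
    rw [← hu1, ← hu2] at l12
    rw [← hu2, ← hu3] at l23
    rw [← hu3, ← hu4] at l34
    rw [← hu1, ← hu3] at l13
    rw [← hu1, ← hu4] at l14
    rw [l12, l23, l34, l13, l14] at hσ
    clear l12 l23 l34 l13 l14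
    revert w12 w23 w34 w13 w14 hdet hσ
    generalize √r1 * Real.cos (θ1 / 2) * (√r2 * Real.sin (θ2 / 2)) -
      √r1 * Real.sin (θ1 / 2) * (√r2 * Real.cos (θ2 / 2)) = a
    generalize √r2 * Real.cos (θ2 / 2) * (√r3 * Real.sin (θ3 / 2)) -
      √r2 * Real.sin (θ2 / 2) * (√r3 * Real.cos (θ3 / 2)) = b
    generalize √r3 * Real.cos (θ3 / 2) * (√r4 * Real.sin (θ4 / 2)) -
      √r3 * Real.sin (θ3 / 2) * (√r4 * Real.cos (θ4 / 2)) = c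
    generalize √r1 * Real.cos (θ1 / 2) * (√r3 * Real.sin (θ3 / 2)) -
      √r1 * Real.sin (θ1 / 2) * (√r3 * Real.cos (θ3 / 2)) = e
    generalize √r1 * Real.cos (θ1 / 2) * (√r4 * Real.sin (θ4 / 2)) -
      √r1 * Real.sin (θ1 / 2) * (√r4 * Real.cos (θ4 / 2)) = d
    intro hσ ha hb hc he hd hdet
    refine ⟨4 * √2 * (a * b * c * d), by positivity, mul_right_cancel₀ he.ne' ?_⟩
    have h2 : (0 : ℝ) < √2 := by positivity
    rw [hdet, hσ]
    field_simp
  obtain ⟨k, hk, hD⟩ := hD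
  refine ⟨?_, ?_, ?_, ?_⟩
  · rw [hD, mul_pos_iff_of_pos_left hk]
  · rw [hD, ← neg_pos, ← mul_neg, mul_pos_iff_of_pos_left hk, neg_pos]
  · rw [hD, mul_eq_zero_iff_left hk.ne']
  · rw [detCols_eq_zero_iff_not_linearIndependent, coplanar_iff_not_linearIndependent]

end
end

section
/- For every n ≥ 4, any two triangulations of the convex n-gon are connected by a finite sequence of flips (Whitehead moves); that is, the flip graph on the set of triangulations of the n-gon is connected. -/
/-- Two vertices of the convex `n`-gon (labelled by `Fin n` in cyclic order) are cyclically
adjacent. -/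
def AdjacentVert (n : ℕ) (a b : Fin n) : Prop :=
  (b : ℕ) = ((a : ℕ) + 1) % n ∨ (a : ℕ) = ((b : ℕ) + 1) % n

/-- `x` lies strictly between `a` and `b` in the cyclic order on `Fin n` (i.e. in the open
arc from `a` to `b` in the positive cyclic direction). -/
def CyclicBetween {n : ℕ} (a x b : Fin n) : Prop :=
  (a < x ∧ x < b) ∨ (x < b ∧ b < a) ∨ (b < a ∧ a < x)

/-- A diagonal of the convex `n`-gon: an unordered pair of distinct, non-adjacent vertices. -/
def IsDiagonal (n : ℕ) (e : Sym2 (Fin n)) : Prop :=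
  ∃ a b : Fin n, e = s(a, b) ∧ a ≠ b ∧ ¬ AdjacentVert n a b

/-- Two diagonals `{a,b}` and `{c,d}` cross: exactly one of `c`, `d` lies strictly between
`a` and `b` in the cyclic order (equivalently, `c` lies strictly between `a` and `b`, and
`d` lies strictly between `b` and `a`). -/
def Crosses {n : ℕ} (e f : Sym2 (Fin n)) : Prop :=
  ∃ a b c d : Fin n, e = s(a, b) ∧ f = s(c, d) ∧ CyclicBetween a c b ∧ CyclicBetween b d a

/-- `D` is a set of pairwise non-crossing diagonals of the `n`-gon. -/
def NonCrossingDiagonals (n : ℕ) (D : Set (Sym2 (Fin n))) : Prop :=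
  (∀ e ∈ D, IsDiagonal n e) ∧ ∀ e ∈ D, ∀ f ∈ D, ¬ Crosses e f

/-- A triangulation of the convex `n`-gon: a maximal set of pairwise non-crossing
diagonals. -/
def IsTriangulation (n : ℕ) (D : Set (Sym2 (Fin n))) : Prop :=
  NonCrossingDiagonals n D ∧
    ∀ e, IsDiagonal n e → e ∉ D → ¬ NonCrossingDiagonals n (insert e D)

/-- `D'` is obtained from the triangulation `D` by a single flip (Whitehead move): removing
one diagonal `e ∈ D` and inserting the unique other diagonal `e' ≠ e` making a
triangulation again. -/
def FlipStep (n : ℕ) (D D' : Set (Sym2 (Fin n))) : Prop :=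
  IsTriangulation n D ∧ IsTriangulation n D' ∧
    ∃ e e' : Sym2 (Fin n), e ∈ D ∧ e' ≠ e ∧ D' = (D \ {e}) ∪ {e'}

/-- The pair `a, b` of natural numbers, in increasing order, is a diagonal of the `n`-gon. -/
def IsOrderedDiagonal (n a b : ℕ) : Prop :=
  a + 2 ≤ b ∧ b < n ∧ (0 < a ∨ b + 1 < n)

/-- The pairs `a < b` and `c < d` interleave. -/
def Interleaves (a b c d : ℕ) : Prop :=
  (a < c ∧ c < b ∧ b < d) ∨ (c < a ∧ a < d ∧ d < b)

/-- `a < b` are the endpoints of a member of `D`. -/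
def HasChord {n : ℕ} (D : Set (Sym2 (Fin n))) (a b : ℕ) : Prop :=
  a < b ∧ ∃ (ha : a < n) (hb : b < n), s(⟨a, ha⟩, ⟨b, hb⟩) ∈ D

/-- The set of all diagonals of the `n`-gon with an endpoint at the vertex `0`. -/
def fanTriangulation (n : ℕ) : Set (Sym2 (Fin n)) :=
  {e | ∃ b : Fin n, ∃ h : 0 < n, e = s(⟨0, h⟩, b) ∧ IsOrderedDiagonal n 0 b}

theorem isDiagonal_mk_iff {n : ℕ} {a b : Fin n} (h : a < b) :
    IsDiagonal n s(a, b) ↔ IsOrderedDiagonal n a b := by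
  have hadj : AdjacentVert n a b ↔ (b : ℕ) = a + 1 ∨ ((a : ℕ) = 0 ∧ (b : ℕ) + 1 = n) := by
    obtain ⟨a, ha⟩ := a
    obtain ⟨b, hb⟩ := b
    simp only [Fin.mk_lt_mk] at h
    simp only [AdjacentVert]
    rw [Nat.mod_eq_of_lt (show a + 1 < n by omega)]
    rcases Nat.lt_or_ge (b + 1) n with h' | h'
    · rw [Nat.mod_eq_of_lt h']
      omega
    · obtain rfl : n = b + 1 := by omega
      rw [Nat.mod_self]
      omega
  have hiff : IsDiagonal n s(a, b) ↔ ¬ AdjacentVert n a b := by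
    constructor
    · rintro ⟨x, y, he, -, hn⟩
      rcases Sym2.eq_iff.1 he with ⟨rfl, rfl⟩ | ⟨rfl, rfl⟩
      · exact hn
      · exact fun hab => hn hab.symm
    · exact fun hn => ⟨a, b, rfl, h.ne, hn⟩
  rw [hiff, hadj]
  have := b.2
  have : (a : ℕ) < b := h
  unfold IsOrderedDiagonal
  omega

theorem crosses_mk_iff {n : ℕ} {a b c d : Fin n} (hab : a < b) (hcd : c < d) :
    Crosses s(a, b) s(c, d) ↔ Interleaves a b c d := by
  constructor
  · rintro ⟨x, y, z, w, he, hf, h₁, h₂⟩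
    simp only [CyclicBetween, Fin.lt_def] at *
    unfold Interleaves
    rcases Sym2.eq_iff.1 he with ⟨rfl, rfl⟩ | ⟨rfl, rfl⟩ <;>
      rcases Sym2.eq_iff.1 hf with ⟨rfl, rfl⟩ | ⟨rfl, rfl⟩ <;> omega
  · rintro (⟨h₁, h₂, h₃⟩ | ⟨h₁, h₂, h₃⟩)
    · exact ⟨a, b, c, d, rfl, rfl, .inl ⟨h₁, h₂⟩, .inr (.inr ⟨hab, h₃⟩)⟩
    · exact ⟨a, b, d, c, rfl, Sym2.eq_swap, .inl ⟨h₂, h₃⟩, .inr (.inl ⟨h₁, hab⟩)⟩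

theorem IsDiagonal.exists_lt {n : ℕ} {e : Sym2 (Fin n)} (h : IsDiagonal n e) :
    ∃ a b : Fin n, a < b ∧ e = s(a, b) := by
  obtain ⟨a, b, rfl, hne, -⟩ := h
  rcases lt_or_gt_of_ne hne with h | h
  · exact ⟨a, b, h, rfl⟩
  · exact ⟨b, a, h, Sym2.eq_swap⟩

theorem hasChord_val_iff {n : ℕ} {D : Set (Sym2 (Fin n))} {a b : Fin n} (h : a < b) :
    HasChord D a b ↔ s(a, b) ∈ D :=
  ⟨fun ⟨_, _, _, hm⟩ => hm, fun hm => ⟨h, a.2, b.2, hm⟩⟩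

theorem isTriangulation_iff {n : ℕ} {D : Set (Sym2 (Fin n))} :
    IsTriangulation n D ↔ (∀ e ∈ D, IsDiagonal n e) ∧
      (∀ a b c d, HasChord D a b → HasChord D c d → ¬ Interleaves a b c d) ∧
      ∀ a b, IsOrderedDiagonal n a b →
        (∀ c d, HasChord D c d → ¬ Interleaves a b c d) → HasChord D a b := by
  constructor
  · rintro ⟨⟨hd, hc⟩, hm⟩
    refine ⟨hd, ?_, ?_⟩
    · rintro a b c d ⟨hab, ha, hb, h₁⟩ ⟨hcd, hc', hd', h₂⟩ hx
      exact hc _ h₁ _ h₂ ((crosses_mk_iff (by exact hab) (by exact hcd)).2 hx)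
    · intro a b hab hx
      have hlt : a < b := by have := hab.1; omega
      have hb : b < n := hab.2.1
      have ha : a < n := hlt.trans hb
      have hlt' : (⟨a, ha⟩ : Fin n) < ⟨b, hb⟩ := hlt
      have hdiag : IsDiagonal n s(⟨a, ha⟩, ⟨b, hb⟩) := (isDiagonal_mk_iff hlt').2 hab
      by_contra hcon
      refine hm _ hdiag (fun h => hcon ⟨hlt, ha, hb, h⟩) ⟨?_, ?_⟩
      · rintro e (rfl | he)
        exacts [hdiag, hd e he]
      · rintro e (rfl | he) f (rfl | hf)
        · rw [crosses_mk_iff hlt' hlt']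
          unfold Interleaves
          omega
        · obtain ⟨c, d, hcd, rfl⟩ := (hd f hf).exists_lt
          rw [crosses_mk_iff hlt' hcd]
          exact hx _ _ ((hasChord_val_iff hcd).2 hf)
        · obtain ⟨c, d, hcd, rfl⟩ := (hd e he).exists_lt
          rw [crosses_mk_iff hcd hlt']
          have := hx _ _ ((hasChord_val_iff hcd).2 he)
          unfold Interleaves at *
          simp only at *
          omega
        · exact hc e he f hf
  · rintro ⟨hd, hc, hm⟩
    refine ⟨⟨hd, ?_⟩, ?_⟩
    · intro e he f hf
      obtain ⟨a, b, hab, rfl⟩ := (hd e he).exists_lt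
      obtain ⟨c, d, hcd, rfl⟩ := (hd f hf).exists_lt
      rw [crosses_mk_iff hab hcd]
      exact hc _ _ _ _ ((hasChord_val_iff hab).2 he) ((hasChord_val_iff hcd).2 hf)
    · rintro e he hne ⟨-, hc'⟩
      obtain ⟨a, b, hab, rfl⟩ := he.exists_lt
      refine hne ((hasChord_val_iff hab).1 (hm a b ((isDiagonal_mk_iff hab).1 he) ?_))
      rintro c d ⟨hcd, h₁, h₂, h⟩
      have := hc' _ (Set.mem_insert _ _) _ (Set.mem_insert_of_mem _ h)
      rwa [crosses_mk_iff hab (by exact hcd)] at this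

theorem IsTriangulation.isOrderedDiagonal {n : ℕ} {D : Set (Sym2 (Fin n))}
    (hD : IsTriangulation n D) {a b : ℕ} (h : HasChord D a b) : IsOrderedDiagonal n a b := by
  obtain ⟨hab, ha, hb, hm⟩ := h
  exact (isDiagonal_mk_iff (by exact hab)).1 (hD.1.1 _ hm)

theorem IsTriangulation.exists_interleaves {n : ℕ} {D : Set (Sym2 (Fin n))}
    (hD : IsTriangulation n D) {a b : ℕ} (h : IsOrderedDiagonal n a b) (hn : ¬ HasChord D a b) :
    ∃ c d, HasChord D c d ∧ Interleaves a b c d := by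
  by_contra! hcon
  exact hn ((isTriangulation_iff.1 hD).2.2 a b h hcon)

theorem FlipStep.symm {n : ℕ} {D D' : Set (Sym2 (Fin n))} (h : FlipStep n D D') :
    FlipStep n D' D := by
  obtain ⟨hD, hD', e, e', he, hne, heq⟩ := h
  have he' : e' ∉ D := by
    intro hmem
    have hsub : D' = D \ {e} := by
      rw [heq, Set.union_eq_left]
      rintro _ rfl
      exact ⟨hmem, hne⟩
    refine hD'.2 e (hD.1.1 e he) (by simp [hsub]) ?_
    rw [hsub, Set.insert_sdiff_singleton, Set.insert_eq_of_mem he]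
    exact hD.1
  refine ⟨hD', hD, e', e, by simp [heq], hne.symm, ?_⟩
  rw [heq]
  ext x
  simp only [Set.mem_union, Set.mem_sdiff, Set.mem_singleton_iff]
  grind

/-- If a diagonal at the vertex `0` is missing from a triangulation, then some member `a, b` lies in a
quadrilateral `0, a, c, b` whose sides belong to the triangulation or to the polygon. -/
theorem IsTriangulation.exists_quadrilateral {n k : ℕ} {D : Set (Sym2 (Fin n))}
    (hD : IsTriangulation n D) (hk : IsOrderedDiagonal n 0 k) (hkD : ¬ HasChord D 0 k) :
    ∃ a b c, HasChord D a b ∧ 0 < a ∧ a < c ∧ c < b ∧ (a = 1 ∨ HasChord D 0 a) ∧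
      (b + 1 = n ∨ HasChord D 0 b) ∧ (c = a + 1 ∨ HasChord D a c) ∧
      (c + 1 = b ∨ HasChord D c b) ∧
      ∀ x y, HasChord D x y → ¬ (x = a ∧ y = b) → ¬ (0 < x ∧ x < c ∧ c < y) := by
  have hdiag : ∀ a b, HasChord D a b → IsOrderedDiagonal n a b := fun a b => hD.isOrderedDiagonal
  have hcross := (isTriangulation_iff.1 hD).2.1
  have hex : ∀ a b, IsOrderedDiagonal n a b → ¬ HasChord D a b →
      ∃ c d, HasChord D c d ∧ Interleaves a b c d := fun a b => hD.exists_interleaves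
  unfold IsOrderedDiagonal Interleaves at *
  -- a longest member `a, b` of `D` separating `k` from `0`
  obtain ⟨a, b, hab, ha, hak, hkb, hmax⟩ : ∃ a b, HasChord D a b ∧ 0 < a ∧ a < k ∧ k < b ∧
      ∀ x y, HasChord D x y → 0 < x → x ≤ a → b ≤ y → x = a ∧ y = b := by
    classical
    have hne : ∃ m, ∃ a b, HasChord D a b ∧ 0 < a ∧ a < k ∧ k < b ∧ n - (b - a) = m := by
      obtain ⟨c, d, h, hx⟩ := hex 0 k hk hkD
      exact ⟨_, c, d, h, by omega, by omega, by omega, rfl⟩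
    obtain ⟨a, b, hab, h₁, h₂, h₃, h₄⟩ := Nat.find_spec hne
    refine ⟨a, b, hab, h₁, h₂, h₃, fun x y hxy h₅ h₆ h₇ => ?_⟩
    have := Nat.find_min' hne ⟨x, y, hxy, h₅, by omega, by omega, rfl⟩
    have := hdiag x y hxy
    omega
  have hab' := hdiag a b hab
  -- the apex `c` of the triangle on the side of `a, b` away from `0`
  obtain ⟨c, hac, hcb, hacD, hcmax⟩ : ∃ c, a < c ∧ c < b ∧ (c = a + 1 ∨ HasChord D a c) ∧
      ∀ x, HasChord D a x → c < x → b ≤ x := by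
    classical
    have hne : ∃ m, ∃ c, a < c ∧ c < b ∧ (c = a + 1 ∨ HasChord D a c) ∧ b - c = m :=
      ⟨_, a + 1, by omega, by omega, .inl rfl, rfl⟩
    obtain ⟨c, h₁, h₂, h₃, h₄⟩ := Nat.find_spec hne
    refine ⟨c, h₁, h₂, h₃, fun x hx h₅ => ?_⟩
    by_contra hlt
    have := Nat.find_min' hne ⟨x, by omega, by omega, .inr hx, rfl⟩
    omega
  have hcbD : c + 1 = b ∨ HasChord D c b := by
    by_contra! h
    obtain ⟨x, y, hxy, hx⟩ := hex c b (by omega) h.2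
    have h₁ := hcross _ _ _ _ hab hxy
    have h₂ : x < c → c < y → x = a := by
      intro h₃ h₄
      rcases hacD with hacD | hacD
      · omega
      · have := hcross _ _ _ _ hacD hxy
        omega
    obtain rfl : x = a := by omega
    have := hcmax y hxy
    omega
  have h0a : a = 1 ∨ HasChord D 0 a := by
    by_contra! h
    obtain ⟨x, y, hxy, hx⟩ := hex 0 a (by omega) h.2
    have := hcross _ _ _ _ hab hxy
    have := hmax x y hxy
    omega
  have h0b : b + 1 = n ∨ HasChord D 0 b := by
    by_contra! h
    obtain ⟨x, y, hxy, hx⟩ := hex 0 b (by omega) h.2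
    have := hcross _ _ _ _ hab hxy
    have := hmax x y hxy
    omega
  have h0c : ∀ x y, HasChord D x y → ¬ (x = a ∧ y = b) → ¬ (0 < x ∧ x < c ∧ c < y) := by
    intro x y hxy hne hx
    have := hcross _ _ _ _ hab hxy
    have := hmax x y hxy
    rcases lt_trichotomy x a with h | rfl | h
    · omega
    · have := hcmax y hxy
      omega
    · rcases hacD with hacD | hacD
      · omega
      · have := hcross _ _ _ _ hacD hxy
        omega
  exact ⟨a, b, c, hab, ha, hac, hcb, h0a, h0b, hacD, hcbD, h0c⟩

/-- If a diagonal at the vertex `0` is missing from a triangulation, then some flip adds a diagonal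
at `0` and removes none. -/
theorem IsTriangulation.exists_flipStep {n k : ℕ} {D : Set (Sym2 (Fin n))}
    (hD : IsTriangulation n D) (hk : IsOrderedDiagonal n 0 k) (hkD : ¬ HasChord D 0 k) :
    ∃ D' c, FlipStep n D D' ∧ (∀ x, HasChord D 0 x → HasChord D' 0 x) ∧
      ¬ HasChord D 0 c ∧ HasChord D' 0 c := by
  obtain ⟨a, b, c, hab, ha, hac, hcb, h0a, h0b, hacD, hcbD, h0c⟩ := hD.exists_quadrilateral hk hkD
  have hcross := (isTriangulation_iff.1 hD).2.1
  have hab' := hD.isOrderedDiagonal hab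
  unfold IsOrderedDiagonal Interleaves at *
  have hn0 : 0 < n := by omega
  have han : a < n := by omega
  have hbn : b < n := by omega
  have hcn : c < n := by omega
  obtain ⟨D', hD'⟩ : ∃ D', D' = (D \ {s((⟨a, han⟩ : Fin n), ⟨b, hbn⟩)}) ∪
    {s((⟨0, hn0⟩ : Fin n), ⟨c, hcn⟩)} := ⟨_, rfl⟩
  have hchord : ∀ x y, HasChord D' x y ↔
      (HasChord D x y ∧ ¬ (x = a ∧ y = b)) ∨ (x = 0 ∧ y = c) := by
    intro x y
    simp only [HasChord, hD', Set.mem_union, Set.mem_sdiff, Set.mem_singleton_iff, Sym2.eq_iff,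
      Fin.mk.injEq]
    constructor
    · rintro ⟨h, h₁, h₂, h₃ | h₃⟩
      · exact .inl ⟨⟨h, h₁, h₂, h₃.1⟩, fun h₄ => h₃.2 (.inl h₄)⟩
      · exact .inr (by omega)
    · rintro (⟨⟨h, h₁, h₂, h₃⟩, h₄⟩ | ⟨rfl, rfl⟩)
      · exact ⟨h, h₁, h₂, .inl ⟨h₃, by omega⟩⟩
      · exact ⟨by omega, hn0, hcn, .inr (by omega)⟩
  have htri : IsTriangulation n D' := by
    refine isTriangulation_iff.2 ⟨?_, ?_, ?_⟩
    · intro e he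
      rw [hD'] at he
      rcases he with he | rfl
      · exact hD.1.1 e he.1
      · exact (isDiagonal_mk_iff (Fin.mk_lt_mk.2 (by omega))).2
          ⟨by simp only; omega, by simp only; omega, .inr (by simp only; omega)⟩
    · intro x y z w hxy hzw
      rw [hchord] at hxy hzw
      unfold Interleaves
      rcases hxy with ⟨hxy, hne⟩ | ⟨rfl, rfl⟩ <;> rcases hzw with ⟨hzw, hne'⟩ | ⟨rfl, rfl⟩
      · exact hcross _ _ _ _ hxy hzw
      · have := h0c _ _ hxy hne
        omega
      · have := h0c _ _ hzw hne'
        omega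
      · omega
    · intro x y hxy hx
      unfold IsOrderedDiagonal Interleaves at *
      have hold : ∀ z w, HasChord D z w → ¬ (z = a ∧ w = b) →
          ¬ ((x < z ∧ z < y ∧ y < w) ∨ (z < x ∧ x < w ∧ w < y)) :=
        fun z w h h' => hx z w ((hchord z w).2 (.inl ⟨h, h'⟩))
      have hnew := hx 0 c ((hchord 0 c).2 (.inr ⟨rfl, rfl⟩))
      rw [hchord]
      by_cases hxyD : HasChord D x y
      · exact .inl ⟨hxyD, by omega⟩
      · obtain ⟨z, w, hzw, hi⟩ := hD.exists_interleaves hxy hxyD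
        unfold Interleaves at hi
        obtain ⟨rfl, rfl⟩ : z = a ∧ w = b := by
          by_contra h
          exact hold z w hzw h hi
        right
        have h₁ := h0a.imp_right fun h => hold _ _ h (by clear * - ha; omega)
        have h₂ := h0b.imp_right fun h => hold _ _ h (by clear * - ha; omega)
        have h₃ := hacD.imp_right fun h => hold _ _ h (by clear * - hcb; omega)
        have h₄ := hcbD.imp_right fun h => hold _ _ h (by clear * - hac; omega)
        clear * - ha hac hcb hxy hi hnew h₁ h₂ h₃ h₄
        omega
  refine ⟨D', c, ⟨hD, htri, _, _, hab.2.2.2, ?_, hD'⟩, fun x hx => ?_, fun h => ?_, ?_⟩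
  · simp only [ne_eq, Sym2.eq_iff, Fin.mk.injEq]
    omega
  · exact (hchord 0 x).2 (.inl ⟨hx, by omega⟩)
  · exact hcross _ _ _ _ h hab (by omega)
  · exact (hchord 0 c).2 (.inr ⟨rfl, rfl⟩)

theorem IsTriangulation.eq_fanTriangulation {n : ℕ} {D : Set (Sym2 (Fin n))}
    (hD : IsTriangulation n D) (h : ∀ k, IsOrderedDiagonal n 0 k → HasChord D 0 k) :
    D = fanTriangulation n := by
  ext e
  constructor
  · intro he
    obtain ⟨a, b, hab, rfl⟩ := (hD.1.1 e he).exists_lt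
    have hc := (hasChord_val_iff hab).2 he
    have hd := hD.isOrderedDiagonal hc
    have hn : 0 < n := a.pos
    rcases Nat.eq_zero_or_pos (a : ℕ) with h0 | h0
    · obtain rfl : a = ⟨0, hn⟩ := Fin.ext h0
      exact ⟨b, hn, rfl, hd⟩
    · have hf := h (a + 1) (by unfold IsOrderedDiagonal at *; omega)
      refine absurd ?_ ((isTriangulation_iff.1 hD).2.1 _ _ _ _ hf hc)
      unfold IsOrderedDiagonal Interleaves at *
      omega
  · rintro ⟨b, hn, rfl, hd⟩
    exact (h b hd).2.2.2

theorem IsTriangulation.reflTransGen_fanTriangulation {n : ℕ} {D : Set (Sym2 (Fin n))}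
    (hD : IsTriangulation n D) : Relation.ReflTransGen (FlipStep n) D (fanTriangulation n) := by
  classical
  induction hm : ((Finset.range n).filter fun k => ¬ HasChord D 0 k).card
    using Nat.strong_induction_on generalizing D with
  | _ m ih =>
    by_cases h : ∀ k, IsOrderedDiagonal n 0 k → HasChord D 0 k
    · rw [hD.eq_fanTriangulation h]
    · push Not at h
      obtain ⟨k, hk, hkD⟩ := h
      obtain ⟨D', c, hstep, hmono, hc, hc'⟩ := hD.exists_flipStep hk hkD
      refine .head hstep (ih _ ?_ hstep.2.1 rfl)
      rw [← hm]
      refine Finset.card_lt_card (Finset.ssubset_iff_subset_ne.2 ⟨?_, ?_⟩)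
      · exact Finset.monotone_filter_right _ fun x _ hx hx' => hx (hmono x hx')
      · intro heq
        have hmem : c ∈ (Finset.range n).filter fun k => ¬ HasChord D 0 k :=
          Finset.mem_filter.2 ⟨Finset.mem_range.2 hc'.2.2.1, hc⟩
        rw [← heq] at hmem
        exact (Finset.mem_filter.1 hmem).2 hc'

/-- For every `n ≥ 4`, any two triangulations of the convex `n`-gon are connected by a
finite sequence of flips: the flip graph is connected. -/
theorem flip_graph_connected (n : ℕ) (hn : 4 ≤ n) (D D' : Set (Sym2 (Fin n)))
    (hD : IsTriangulation n D) (hD' : IsTriangulation n D') :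
    Relation.ReflTransGen (FlipStep n) D D' :=
  have : Std.Symm (FlipStep n) := ⟨fun _ _ => FlipStep.symm⟩
  hD.reflTransGen_fanTriangulation.trans (symm hD'.reflTransGen_fanTriangulation)
end

section
/- Let D₀ be a triangulation of the convex pentagon (n = 5, so D₀ consists of exactly two diagonals). Define D₁ = flip_e(D₀) for either diagonal e of D₀, and recursively Dₖ₊₁ = flip_{eₖ}(Dₖ), where eₖ is the unique diagonal belonging to both Dₖ and Dₖ₋₁. Then D₅ = D₀: five successive such flips return the original triangulation. (This is the pentagon relation for Whitehead moves.) -/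
open Classical in
/-- The flip (Whitehead move) of a triangulation `D` along `e ∈ D`: replace `e` by the
unique other diagonal `e'` such that `(D \ {e}) ∪ {e'}` is again a triangulation. -/
noncomputable def flipDiag (n : ℕ) (D : Set (Sym2 (Fin n))) (e : Sym2 (Fin n)) :
    Set (Sym2 (Fin n)) :=
  if h : ∃ e', e' ≠ e ∧ IsTriangulation n ((D \ {e}) ∪ {e'}) then
    (D \ {e}) ∪ {h.choose}
  else D

/-- The diagonal of the pentagon joining the vertices `i` and `i + 2`. -/
def pentagonDiag (i : Fin 5) : Sym2 (Fin 5) := s(i, i + 2)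

theorem pentagonDiag_injective : Function.Injective pentagonDiag := by
  intro i j h
  rw [pentagonDiag, pentagonDiag, Sym2.eq_iff] at h
  revert i j
  decide

theorem isDiagonal_pentagonDiag (i : Fin 5) : IsDiagonal 5 (pentagonDiag i) := by
  refine ⟨i, i + 2, rfl, ?_⟩
  unfold AdjacentVert
  revert i
  decide

theorem IsDiagonal.exists_eq_pentagonDiag {e : Sym2 (Fin 5)} (h : IsDiagonal 5 e) :
    ∃ i, e = pentagonDiag i := by
  obtain ⟨a, b, rfl, hab, hadj⟩ := h
  simp only [pentagonDiag, Sym2.eq_iff]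
  unfold AdjacentVert at hadj
  revert a b
  decide

theorem crosses_pentagonDiag_iff (i j : Fin 5) :
    Crosses (pentagonDiag i) (pentagonDiag j) ↔ j = i + 1 ∨ i = j + 1 := by
  constructor
  · rintro ⟨a, b, c, d, hab, hcd, hc, hd⟩
    unfold CyclicBetween at hc hd
    rw [pentagonDiag, Sym2.eq_iff] at hab hcd
    rcases hab with ⟨rfl, rfl⟩ | ⟨rfl, rfl⟩ <;> rcases hcd with ⟨rfl, rfl⟩ | ⟨rfl, rfl⟩ <;>
      revert i j <;> decide
  · rintro (rfl | rfl)
    · refine ⟨i, i + 2, i + 1, i + 1 + 2, rfl, rfl, ?_⟩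
      unfold CyclicBetween
      revert i
      decide
    · refine ⟨j + 1, j + 1 + 2, j + 2, j, rfl, Sym2.eq_swap, ?_⟩
      unfold CyclicBetween
      revert j
      decide

theorem isTriangulation_pentagonDiag_pair (i : Fin 5) {s : Fin 5} (hs : s = 2 ∨ s = 3) :
    IsTriangulation 5 {pentagonDiag i, pentagonDiag (i + s)} := by
  refine ⟨⟨?_, ?_⟩, ?_⟩
  · rintro e (rfl | rfl) <;> exact isDiagonal_pentagonDiag _
  · rintro e (rfl | rfl) f (rfl | rfl) <;> rw [crosses_pentagonDiag_iff] <;> revert i s <;> decide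
  · intro e he hmem hnc
    obtain ⟨k, rfl⟩ := he.exists_eq_pentagonDiag
    have h₁ := hnc.2 _ (Set.mem_insert _ _) (pentagonDiag i) (by simp)
    have h₂ := hnc.2 _ (Set.mem_insert _ _) (pentagonDiag (i + s)) (by simp)
    simp only [Set.mem_insert_iff, Set.mem_singleton_iff, pentagonDiag_injective.eq_iff] at hmem
    rw [crosses_pentagonDiag_iff] at h₁ h₂
    clear hnc he
    revert i s k
    decide

theorem IsTriangulation.eq_pentagonDiag_pair {D : Set (Sym2 (Fin 5))} (hD : IsTriangulation 5 D)
    {i : Fin 5} (hi : pentagonDiag i ∈ D) :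
    ∃ s : Fin 5, (s = 2 ∨ s = 3) ∧ D = {pentagonDiag i, pentagonDiag (i + s)} := by
  obtain ⟨⟨hdiag, hnc⟩, hmax⟩ := hD
  have key : ∃ s : Fin 5, (s = 2 ∨ s = 3) ∧ pentagonDiag (i + s) ∈ D := by
    by_contra! hcon
    have h₂ := hcon 2 (Or.inl rfl)
    have h₃ := hcon 3 (Or.inr rfl)
    have hall : ∀ e ∈ D, e = pentagonDiag i := by
      intro e he
      obtain ⟨k, rfl⟩ := (hdiag e he).exists_eq_pentagonDiag
      have hc := hnc _ hi _ he
      rw [crosses_pentagonDiag_iff] at hc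
      have hk₂ : k ≠ i + 2 := by rintro rfl; exact h₂ he
      have hk₃ : k ≠ i + 3 := by rintro rfl; exact h₃ he
      congr 1
      clear hcon h₂ h₃ hi he
      revert i k
      decide
    have hD : D = {pentagonDiag i} := Set.eq_singleton_iff_unique_mem.2 ⟨hi, hall⟩
    refine hmax _ (isDiagonal_pentagonDiag (i + 2)) h₂ ?_
    rw [hD, Set.pair_comm]
    exact (isTriangulation_pentagonDiag_pair i (Or.inl rfl)).1
  obtain ⟨s, hs, hmem⟩ := key
  refine ⟨s, hs, Set.Subset.antisymm (fun e he => ?_) (Set.pair_subset hi hmem)⟩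
  obtain ⟨k, rfl⟩ := (hdiag e he).exists_eq_pentagonDiag
  have h₁ := hnc _ hi _ he
  have h₂ := hnc _ hmem _ he
  rw [crosses_pentagonDiag_iff] at h₁ h₂
  simp only [Set.mem_insert_iff, Set.mem_singleton_iff, pentagonDiag_injective.eq_iff]
  clear hi hmem he
  revert i s k
  decide

theorem flipDiag_pentagonDiag_pair (i : Fin 5) {s : Fin 5} (hs : s = 2 ∨ s = 3) :
    flipDiag 5 {pentagonDiag i, pentagonDiag (i + s)} (pentagonDiag i) =
      {pentagonDiag (i + s), pentagonDiag (i + s + s)} := by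
  have hne : pentagonDiag (i + s) ≠ pentagonDiag i := by
    rw [pentagonDiag_injective.ne_iff]
    revert i s
    decide
  have hne' : pentagonDiag (i + s + s) ≠ pentagonDiag i := by
    rw [pentagonDiag_injective.ne_iff]
    revert i s
    decide
  have hdiff : ({pentagonDiag i, pentagonDiag (i + s)} : Set (Sym2 (Fin 5))) \ {pentagonDiag i} =
      {pentagonDiag (i + s)} := by
    rw [Set.insert_sdiff_of_mem _ (Set.mem_singleton _), Set.sdiff_singleton_eq_self]
    exact hne.symm
  have hex : ∃ e', e' ≠ pentagonDiag i ∧ IsTriangulation 5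
      (({pentagonDiag i, pentagonDiag (i + s)} : Set (Sym2 (Fin 5))) \ {pentagonDiag i} ∪ {e'}) :=
    ⟨pentagonDiag (i + s + s), hne', by
      rw [hdiff]; exact isTriangulation_pentagonDiag_pair (i + s) hs⟩
  obtain ⟨hchoose, htri⟩ := hex.choose_spec
  rw [flipDiag, dif_pos hex]
  generalize hex.choose = f at hchoose htri ⊢
  rw [hdiff] at htri ⊢
  obtain ⟨t, ht, heq⟩ := htri.eq_pentagonDiag_pair (i := i + s) (by simp)
  rw [heq]
  have hts : t = s ∨ i + s + t = i := by
    clear heq htri hchoose hex hdiff hne' hne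
    revert i s t
    decide
  rcases hts with rfl | hts
  · rfl
  · have hmem : pentagonDiag i ∈ ({pentagonDiag (i + s), pentagonDiag (i + s + t)} :
        Set (Sym2 (Fin 5))) := by rw [hts]; simp
    rw [← heq] at hmem
    rcases hmem with h | h
    · exact absurd h.symm hne
    · exact absurd h.symm hchoose

/-- The pentagon relation: starting from a triangulation `D 0` of the convex pentagon,
flip either diagonal `e` to get `D 1`, and then recursively let `D (k+1)` be the flip of
`D k` along the unique diagonal belonging to both `D k` and `D (k-1)`.  Then `D 5 = D 0`:
five successive such flips return the original triangulation. -/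
theorem pentagon_relation (D : ℕ → Set (Sym2 (Fin 5)))
    (hD0 : IsTriangulation 5 (D 0)) (e : Sym2 (Fin 5)) (he : e ∈ D 0)
    (hD1 : D 1 = flipDiag 5 (D 0) e)
    (hrec : ∀ k, 1 ≤ k → k ≤ 4 → ∀ ek, ek ∈ D k → ek ∈ D (k - 1) →
      D (k + 1) = flipDiag 5 (D k) ek) :
    D 5 = D 0 := by
  obtain ⟨i, rfl⟩ := (hD0.1.1 e he).exists_eq_pentagonDiag
  obtain ⟨s, hs, h₀⟩ := hD0.eq_pentagonDiag_pair he
  rw [h₀, flipDiag_pentagonDiag_pair i hs] at hD1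
  have step : ∀ k, 1 ≤ k → k ≤ 4 → ∀ j, D (k - 1) = {pentagonDiag j, pentagonDiag (j + s)} →
      D k = {pentagonDiag (j + s), pentagonDiag (j + s + s)} →
      D (k + 1) = {pentagonDiag (j + s + s), pentagonDiag (j + s + s + s)} := by
    intro k hk hk' j hprev hcur
    rw [hrec k hk hk' (pentagonDiag (j + s)) (by simp [hcur]) (by simp [hprev]), hcur,
      flipDiag_pentagonDiag_pair (j + s) hs]
  have h₂ := step 1 (by norm_num) (by norm_num) _ h₀ hD1
  have h₃ := step 2 (by norm_num) (by norm_num) _ hD1 h₂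
  have h₄ := step 3 (by norm_num) (by norm_num) _ h₂ h₃
  have h₅ := step 4 (by norm_num) (by norm_num) _ h₃ h₄
  have hi : i + s + s + s + s + s = i := by
    clear * - i s
    revert i s
    decide
  rw [h₅, h₀, hi]
end
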